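/- Let n_1, n_2, e be positive integers and let P(X,S), Q(X,Y), F(X,S) be polynomials with coefficients in k[X], monic of degrees d := deg_S P ≥ 2, m := deg_Y Q ≥ 2 and l := deg_S F ≥ 2 respectively. Then the ring R_{n_1,e,P,Q} = k[X,Y,Z]/⟨X^{n_1}Y − P(X, Q(X,Y) − X^eZ)⟩ is not isomorphic as a k-algebra to the Danielewski domain B_{n_2,F} = k[X,S,Y]/⟨X^{n_2}Y − F(X,S)⟩. -/

import Mathlib

open MvPolynomial

/-- A locally nilpotent `k`-derivation. -/
def IsLND {k B : Type*} [CommRing k] [CommRing B] [Algebra k B]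
    (D : Derivation k B B) : Prop :=
  ∀ a : B, ∃ n : ℕ, ((D.toLinearMap : Module.End k B) ^ n) a = 0

noncomputable section

variable (k : Type*) [Field k] [CharZero k]

/-- `P(X,T) = T^d + f_{d-1}(X) T^{d-1} + ⋯ + f_0(X)` evaluated at `T`, inside `k[X,Y,Z]`
(the variable `X` has index 0). -/
def Pat (d : ℕ) (f : ℕ → Polynomial k) (T : MvPolynomial (Fin 3) k) :
    MvPolynomial (Fin 3) k :=
  T ^ d + ∑ i ∈ Finset.range d, Polynomial.aeval (X 0) (f i) * T ^ i

/-- `Q(X,Y) = Y^m + g_{m-1}(X) Y^{m-1} + ⋯ + g_0(X)` in `k[X,Y,Z]`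
(variables `X = 0`, `Y = 1`, `Z = 2`). -/
def Qpoly (m : ℕ) (g : ℕ → Polynomial k) : MvPolynomial (Fin 3) k :=
  X 1 ^ m + ∑ j ∈ Finset.range m, Polynomial.aeval (X 0) (g j) * X 1 ^ j

/-- The ideal `⟨XⁿY - P(X, Q(X,Y) - XᵉZ)⟩` of `k[X,Y,Z]` (variables `X = 0`, `Y = 1`, `Z = 2`). -/
def RIdeal (n e d m : ℕ) (f g : ℕ → Polynomial k) : Ideal (MvPolynomial (Fin 3) k) :=
  Ideal.span {X 0 ^ n * X 1 - Pat k d f (Qpoly k m g - X 0 ^ e * X 2)}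

/-- `R_{n,e,P,Q} = k[X,Y,Z]/⟨XⁿY - P(X, Q(X,Y) - XᵉZ)⟩`. -/
def RRing (n e d m : ℕ) (f g : ℕ → Polynomial k) : Type _ :=
  MvPolynomial (Fin 3) k ⧸ RIdeal k n e d m f g

instance (n e d m : ℕ) (f g : ℕ → Polynomial k) : CommRing (RRing k n e d m f g) :=
  Ideal.Quotient.commRing _

instance (n e d m : ℕ) (f g : ℕ → Polynomial k) : Algebra k (RRing k n e d m f g) :=
  Ideal.Quotient.algebra k

variable (n e d m : ℕ) (f g : ℕ → Polynomial k)

/-- The class `x` of `X` in `R_{n,e,P,Q}`. -/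
def xel : RRing k n e d m f g := Ideal.Quotient.mk _ (X 0)

/-- The class `y` of `Y` in `R_{n,e,P,Q}`. -/
def yel : RRing k n e d m f g := Ideal.Quotient.mk _ (X 1)

/-- The class `z` of `Z` in `R_{n,e,P,Q}`. -/
def zel : RRing k n e d m f g := Ideal.Quotient.mk _ (X 2)

/-- The element `s = Q(x,y) - xᵉz` of `R_{n,e,P,Q}`. -/
def sel : RRing k n e d m f g := Ideal.Quotient.mk _ (Qpoly k m g - X 0 ^ e * X 2)

/-- `(∂P/∂S)(x,s)` in `R_{n,e,P,Q}`. -/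
def PSel : RRing k n e d m f g :=
  (d : RRing k n e d m f g) * sel k n e d m f g ^ (d - 1) +
    ∑ i ∈ Finset.range d, (i : RRing k n e d m f g) *
      Polynomial.aeval (xel k n e d m f g) (f i) * sel k n e d m f g ^ (i - 1)

/-- `(∂Q/∂Y)(x,y)` in `R_{n,e,P,Q}`. -/
def QYel : RRing k n e d m f g :=
  (m : RRing k n e d m f g) * yel k n e d m f g ^ (m - 1) +
    ∑ j ∈ Finset.range m, (j : RRing k n e d m f g) *
      Polynomial.aeval (xel k n e d m f g) (g j) * yel k n e d m f g ^ (j - 1)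

end

noncomputable section

variable (k : Type*) [Field k] [CharZero k]

/-- The ideal `⟨XⁿY - F(X,S)⟩` of `k[X,S,Y]` (variables `X = 0`, `S = 1`, `Y = 2`). -/
def DanIdeal (n l : ℕ) (h : ℕ → Polynomial k) : Ideal (MvPolynomial (Fin 3) k) :=
  Ideal.span {X 0 ^ n * X 2 - Pat k l h (X 1)}

/-- The Danielewski domain `B_{n,F} = k[X,S,Y]/⟨XⁿY - F(X,S)⟩`. -/
def DanRing (n l : ℕ) (h : ℕ → Polynomial k) : Type _ :=
  MvPolynomial (Fin 3) k ⧸ DanIdeal k n l h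

instance (n l : ℕ) (h : ℕ → Polynomial k) : CommRing (DanRing k n l h) :=
  Ideal.Quotient.commRing _

instance (n l : ℕ) (h : ℕ → Polynomial k) : Algebra k (DanRing k n l h) :=
  Ideal.Quotient.algebra k

end

section LexValuation

open Polynomial

variable {k : Type*} [Field k]

/-- The value group of the degree-then-order valuation on `k((T))[S]`. -/
abbrev LexValueGroup : Type := WithZero (Multiplicative (ℤ ×ₗ ℤ))

open Classical in
/-- The function underlying `lexValuation`. -/
noncomputable def lexValue (p : (LaurentSeries k)[X]) : LexValueGroup :=
  if p = 0 then 0 else WithZero.exp (toLex ((p.natDegree : ℤ), -p.leadingCoeff.order))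

theorem lexValue_of_ne_zero {p : (LaurentSeries k)[X]} (hp : p ≠ 0) :
    lexValue p = WithZero.exp (toLex ((p.natDegree : ℤ), -p.leadingCoeff.order)) :=
  if_neg hp

theorem lexValue_add_le {p q : (LaurentSeries k)[X]} (hpq : p.natDegree ≤ q.natDegree)
    (hq : q ≠ 0) (hp : p ≠ 0) : lexValue (p + q) ≤ max (lexValue p) (lexValue q) := by
  by_cases h : p + q = 0
  · simp [lexValue, h]
  rw [lexValue_of_ne_zero h, lexValue_of_ne_zero hq, lexValue_of_ne_zero hp]
  have hle : (p + q).natDegree ≤ q.natDegree := by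
    simpa [hpq] using natDegree_add_le p q
  rcases hle.lt_or_eq with hlt | heq
  · refine le_max_of_le_right (WithZero.exp_le_exp.2 ?_)
    rw [Prod.Lex.toLex_le_toLex]
    exact Or.inl (Nat.cast_lt.2 hlt)
  have hlc : (p + q).leadingCoeff = p.coeff q.natDegree + q.leadingCoeff := by
    rw [leadingCoeff, heq, Polynomial.coeff_add, leadingCoeff]
  rcases hpq.lt_or_eq with hlt | heq'
  · rw [coeff_eq_zero_of_natDegree_lt hlt, zero_add] at hlc
    rw [hlc, heq]
    exact le_max_right _ _
  have hlc' : (p + q).leadingCoeff = p.leadingCoeff + q.leadingCoeff := by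
    rw [hlc, ← heq', leadingCoeff, leadingCoeff]
  have hmin := HahnSeries.min_order_le_order_add (x := p.leadingCoeff) (y := q.leadingCoeff)
    (by rw [← hlc']; exact leadingCoeff_ne_zero.2 h)
  rw [← hlc'] at hmin
  rw [heq, heq']
  rcases min_le_iff.1 hmin with hm | hm
  · refine le_max_of_le_left (WithZero.exp_le_exp.2 ?_)
    rw [Prod.Lex.toLex_le_toLex]
    right
    exact ⟨rfl, neg_le_neg hm⟩
  · refine le_max_of_le_right (WithZero.exp_le_exp.2 ?_)
    rw [Prod.Lex.toLex_le_toLex]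
    right
    exact ⟨rfl, neg_le_neg hm⟩

/-- The valuation on `k((T))[S]` comparing first the degree in `S` and then the order in `T` of
the leading coefficient. -/
noncomputable def lexValuation : Valuation (LaurentSeries k)[X] LexValueGroup where
  toFun := lexValue
  map_zero' := if_pos rfl
  map_one' := by
    rw [lexValue_of_ne_zero one_ne_zero]
    simp
  map_mul' p q := by
    by_cases hp : p = 0
    · simp [lexValue, hp]
    by_cases hq : q = 0
    · simp [lexValue, hq]
    rw [lexValue_of_ne_zero (mul_ne_zero hp hq), lexValue_of_ne_zero hp, lexValue_of_ne_zero hq,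
      ← WithZero.exp_add, natDegree_mul hp hq, leadingCoeff_mul,
      HahnSeries.order_mul (leadingCoeff_ne_zero.2 hp) (leadingCoeff_ne_zero.2 hq), ← toLex_add]
    congr 2
    ext
    · simp
    · simp
      ring
  map_add_le_max' p q := by
    by_cases hp : p = 0
    · simp [hp]
    by_cases hq : q = 0
    · simp [hq]
    rcases le_total p.natDegree q.natDegree with h | h
    · exact lexValue_add_le h hq hp
    · rw [add_comm, max_comm]
      exact lexValue_add_le h hp hq

theorem lexValuation_of_ne_zero {p : (LaurentSeries k)[X]} (hp : p ≠ 0) :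
    lexValuation p = WithZero.exp (toLex ((p.natDegree : ℤ), -p.leadingCoeff.order)) :=
  lexValue_of_ne_zero hp

theorem lexValuation_eq_zero_iff {p : (LaurentSeries k)[X]} : lexValuation p = 0 ↔ p = 0 := by
  refine ⟨fun h => ?_, fun h => by rw [h, map_zero]⟩
  by_contra hp
  rw [lexValuation_of_ne_zero hp] at h
  exact WithZero.exp_ne_zero h

theorem algebraMap_laurentSeries (c : k) :
    algebraMap k (LaurentSeries k) c = HahnSeries.single 0 c := by
  rw [HahnSeries.algebraMap_apply']
  simp

theorem lexValuation_algebraMap {c : k} (hc : c ≠ 0) :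
    lexValuation (algebraMap k (LaurentSeries k)[X] c) = 1 := by
  have hc' : algebraMap k (LaurentSeries k) c ≠ 0 := by simpa using hc
  rw [Polynomial.algebraMap_apply, lexValuation_of_ne_zero (by simpa using hc)]
  have : (algebraMap k (LaurentSeries k) c).order = 0 := by
    rw [algebraMap_laurentSeries, HahnSeries.order_single hc]
  rw [natDegree_C, leadingCoeff_C, this]
  rfl

theorem exists_lexValuation_sub_lt {p q : (LaurentSeries k)[X]} (hq : q ≠ 0)
    (h : lexValuation p = lexValuation q) :
    ∃ c : k, lexValuation (p - algebraMap k _ c * q) < lexValuation q := by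
  have hp : p ≠ 0 := by
    rintro rfl
    rw [map_zero] at h
    exact hq (lexValuation_eq_zero_iff.1 h.symm)
  have h' := h
  rw [lexValuation_of_ne_zero hp, lexValuation_of_ne_zero hq, WithZero.exp_inj,
    toLex_inj, Prod.mk.injEq] at h'
  obtain ⟨hdeg, hord⟩ := h'
  have hdeg : p.natDegree = q.natDegree := by exact_mod_cast hdeg
  have hord : p.leadingCoeff.order = q.leadingCoeff.order := neg_injective hord
  set i := q.leadingCoeff.order
  have hqi : q.leadingCoeff.coeff i ≠ 0 := by
    rw [Ne, HahnSeries.coeff_order_eq_zero]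
    exact leadingCoeff_ne_zero.2 hq
  refine ⟨p.leadingCoeff.coeff i / q.leadingCoeff.coeff i, ?_⟩
  set c := p.leadingCoeff.coeff i / q.leadingCoeff.coeff i
  rw [Polynomial.algebraMap_apply, algebraMap_laurentSeries]
  set γ : LaurentSeries k := HahnSeries.single 0 c with hγ
  by_cases h0 : p - Polynomial.C γ * q = 0
  · rw [h0, map_zero]
    exact zero_lt_iff.2 (by rwa [Ne, lexValuation_eq_zero_iff])
  rw [lexValuation_of_ne_zero h0, lexValuation_of_ne_zero hq, WithZero.exp_lt_exp,
    Prod.Lex.toLex_lt_toLex]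
  have hle : (p - Polynomial.C γ * q).natDegree ≤ q.natDegree := by
    refine (natDegree_sub_le _ _).trans (max_le hdeg.le (natDegree_C_mul_le _ _))
  rcases hle.lt_or_eq with hlt | heq
  · exact Or.inl (Nat.cast_lt.2 hlt)
  right
  refine ⟨by simp only [heq], neg_lt_neg ?_⟩
  have hlc : (p - Polynomial.C γ * q).leadingCoeff = p.leadingCoeff - γ * q.leadingCoeff := by
    rw [leadingCoeff, heq, Polynomial.coeff_sub, Polynomial.coeff_C_mul, leadingCoeff,
      leadingCoeff, hdeg]
  have hne : p.leadingCoeff - γ * q.leadingCoeff ≠ 0 := by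
    rw [← hlc]
    exact leadingCoeff_ne_zero.2 h0
  rw [hlc, ← Int.add_one_le_iff, HahnSeries.le_order_iff_forall hne]
  intro j hj
  rw [HahnSeries.coeff_sub, hγ, HahnSeries.coeff_single_zero_mul]
  rcases (Int.lt_add_one_iff.1 hj).lt_or_eq with hlt | rfl
  · rw [HahnSeries.coeff_eq_zero_of_lt_order hlt, mul_zero, sub_zero]
    exact HahnSeries.coeff_eq_zero_of_lt_order (hord ▸ hlt)
  · rw [div_mul_cancel₀ _ hqi, sub_self]

end LexValuation

section LeadingDerivation

variable {k A Γ₀ : Type*} [Field k] [CommRing A] [Algebra k A]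
  [LinearOrderedCommGroupWithZero Γ₀]

theorem IsLND.exists_iterate_eq_zero {D : Derivation k A A} (hD : IsLND D) (a : A) :
    ∃ n : ℕ, (⇑D)^[n] a = 0 := by
  obtain ⟨n, hn⟩ := hD a
  refine ⟨n, ?_⟩
  rw [Module.End.pow_apply] at hn
  exact hn

/-- If a locally nilpotent derivation `D` changes values of a valuation with one-dimensional
graded pieces by at most the factor attained at `a₀`, then its leading part is a locally nilpotent
derivation of the associated graded ring; `deg` is the degree function of that leading part. -/
theorem IsLND.exists_degree_function [CharZero k] {v : Valuation A Γ₀}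
    (hv : ∀ a, v a = 0 → a = 0)
    (hc : ∀ c : k, c ≠ 0 → v (algebraMap k A c) = 1)
    (hres : ∀ a b : A, b ≠ 0 → v a = v b → ∃ c : k, v (a - algebraMap k A c * b) < v b)
    {D : Derivation k A A} (hD : IsLND D) {a₀ : A} (hDa₀ : D a₀ ≠ 0)
    (hmax : ∀ a, v (D a) * v a₀ ≤ v (D a₀) * v a) :
    ∃ deg : A → ℕ, (∀ a b, a ≠ 0 → b ≠ 0 → deg (a * b) = deg a + deg b) ∧
      (∀ a b, a ≠ 0 → b ≠ 0 → v a = v b → deg a = deg b) ∧ 0 < deg a₀ ∧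
      ∀ a, a ≠ 0 → 0 < deg a →
        D a ≠ 0 ∧ v (D a) * v a₀ = v (D a₀) * v a ∧ deg (D a) + 1 = deg a := by
  have hv' : ∀ a, a ≠ 0 → 0 < v a := fun a ha => zero_lt_iff.2 fun h => ha (hv a h)
  have hmul : ∀ a b : A, a ≠ 0 → b ≠ 0 → a * b ≠ 0 := fun a b ha hb h => by
    have := mul_pos (hv' a ha) (hv' b hb)
    rw [← map_mul, h, map_zero] at this
    exact this.false
  have ha₀ : a₀ ≠ 0 := by
    rintro rfl
    exact hDa₀ (map_zero D)
  have hM : 0 < v (D a₀) := hv' _ hDa₀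
  have hc' : ∀ c : k, v (algebraMap k A c) ≤ 1 := fun c => by
    by_cases h : c = 0
    · simp [h]
    · exact (hc c h).le
  set N : k → A → A := fun γ a => a₀ * D a - algebraMap k A γ * (a * D a₀) with hN
  have hα : ∀ a, ∃ γ : k, a ≠ 0 → v (N γ a) < v (D a₀) * v a := by
    intro a
    by_cases ha : a = 0
    · exact ⟨0, fun h => absurd ha h⟩
    rcases (hmax a).lt_or_eq with h | h
    · refine ⟨0, fun _ => ?_⟩
      simpa [hN, mul_comm] using h
    · obtain ⟨c, hc⟩ := hres (a₀ * D a) (a * D a₀) (hmul _ _ ha hDa₀) (by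
        rw [map_mul, map_mul, mul_comm, h, mul_comm])
      refine ⟨c, fun _ => ?_⟩
      rw [map_mul, mul_comm (v a)] at hc
      exact hc
  choose α hα using hα
  have huniq : ∀ a γ, a ≠ 0 → v (N γ a) < v (D a₀) * v a → α a = γ := by
    intro a γ ha h
    by_contra hne
    have h1 : N γ a - N (α a) a = algebraMap k A (α a - γ) * (a * D a₀) := by
      simp only [hN, map_sub]
      ring
    have h2 := v.map_sub (N γ a) (N (α a) a)
    rw [h1, map_mul, hc _ (sub_ne_zero.2 hne), one_mul, map_mul, mul_comm] at h2
    exact (max_lt h (hα a ha)).not_ge h2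
  have hadd : ∀ a b, a ≠ 0 → b ≠ 0 → α (a * b) = α a + α b := by
    intro a b ha hb
    refine huniq _ _ (hmul a b ha hb) ?_
    have : N (α a + α b) (a * b) = b * N (α a) a + a * N (α b) b := by
      simp only [hN, map_add, Derivation.leibniz, smul_eq_mul]
      ring
    rw [this]
    refine (v.map_add _ _).trans_lt (max_lt ?_ ?_)
    · rw [map_mul, map_mul, mul_comm (v b), ← mul_assoc]
      exact mul_lt_mul_of_pos_right (hα a ha) (hv' b hb)
    · rw [map_mul, map_mul, mul_left_comm]
      exact mul_lt_mul_of_pos_left (hα b hb) (hv' a ha)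
  have hNle : ∀ γ a, v (N γ a) ≤ v (D a₀) * v a := by
    intro γ a
    refine (v.map_sub _ _).trans (max_le ?_ ?_)
    · rw [map_mul, mul_comm]
      exact hmax a
    · rw [map_mul, map_mul, mul_comm (v a)]
      exact mul_le_of_le_one_left' (hc' γ)
  have hcongr : ∀ a b, a ≠ 0 → b ≠ 0 → v a = v b → α a = α b := by
    intro a b ha hb hab
    obtain ⟨c, hc⟩ := hres a b hb hab
    refine huniq _ _ ha ?_
    have : N (α b) a = algebraMap k A c * N (α b) b + N (α b) (a - algebraMap k A c * b) := by
      simp only [hN, map_sub, Derivation.leibniz, smul_eq_mul, Derivation.map_algebraMap]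
      ring
    rw [this]
    refine (v.map_add _ _).trans_lt (max_lt ?_ ?_)
    · rw [map_mul, hab]
      exact (mul_le_of_le_one_left' (hc' c)).trans_lt (hα b hb)
    · rw [hab]
      exact (hNle _ _).trans_lt (mul_lt_mul_of_pos_left hc hM)
  have hα₀ : α a₀ = 1 := by
    refine huniq _ _ ha₀ ?_
    simp only [hN, map_one, one_mul, sub_self, map_zero]
    exact mul_pos hM (hv' a₀ ha₀)
  have hstep : ∀ a, a ≠ 0 → α a ≠ 0 → D a ≠ 0 ∧ v (D a) * v a₀ = v (D a₀) * v a ∧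
      α (D a) = α a + (α (D a₀) - 1) := by
    intro a ha h
    have heq : v (D a) * v a₀ = v (D a₀) * v a := by
      refine (hmax a).antisymm (not_lt.1 fun hlt => h (huniq a 0 ha ?_))
      simpa [hN, mul_comm] using hlt
    have hDa : D a ≠ 0 := by
      intro h0
      rw [h0, map_zero, zero_mul] at heq
      exact (mul_pos hM (hv' a ha)).ne heq
    refine ⟨hDa, heq, ?_⟩
    have := hcongr (a₀ * D a) (a * D a₀) (hmul _ _ ha₀ hDa) (hmul _ _ ha hDa₀) (by
      rw [map_mul, map_mul, mul_comm, heq, mul_comm])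
    rw [hadd _ _ ha₀ hDa, hadd _ _ ha hDa₀, hα₀] at this
    linear_combination this
  set β := α (D a₀) - 1
  have hnil : ∀ (n : ℕ) a, a ≠ 0 → (⇑D)^[n] a = 0 → ∃ t : ℕ, α a + t * β = 0 := by
    intro n
    induction n with
    | zero => exact fun a ha h => absurd h ha
    | succ n ih =>
      intro a ha h
      by_cases h0 : α a = 0
      · exact ⟨0, by simp [h0]⟩
      obtain ⟨h1, -, h2⟩ := hstep a ha h0
      obtain ⟨t, ht⟩ := ih (D a) h1 h
      refine ⟨t + 1, ?_⟩
      rw [h2] at ht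
      push_cast
      linear_combination ht
  have hdeg : ∀ a, ∃ t : ℕ, a ≠ 0 → α a + t * β = 0 := by
    intro a
    by_cases ha : a = 0
    · exact ⟨0, fun h => absurd ha h⟩
    obtain ⟨n, hn⟩ := hD.exists_iterate_eq_zero a
    obtain ⟨t, ht⟩ := hnil n a ha hn
    exact ⟨t, fun _ => ht⟩
  choose deg hdeg using hdeg
  have hβ : β ≠ 0 := by
    intro h
    have := hdeg a₀ ha₀
    rw [h, hα₀, mul_zero, add_zero] at this
    exact one_ne_zero this
  have hdeg_uniq : ∀ (s t : ℕ), (s : k) * β = t * β → s = t := fun s t h =>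
    Nat.cast_injective (mul_right_cancel₀ hβ h)
  refine ⟨deg, ?_, ?_, ?_, ?_⟩
  · intro a b ha hb
    refine hdeg_uniq _ _ ?_
    have := hdeg (a * b) (hmul a b ha hb)
    rw [hadd a b ha hb] at this
    push_cast
    linear_combination this - hdeg a ha - hdeg b hb
  · intro a b ha hb hab
    refine hdeg_uniq _ _ ?_
    have := hdeg a ha
    rw [hcongr a b ha hb hab] at this
    linear_combination this - hdeg b hb
  · refine Nat.pos_of_ne_zero fun h => ?_
    have := hdeg a₀ ha₀
    rw [h, hα₀, Nat.cast_zero, zero_mul, add_zero] at this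
    exact one_ne_zero this
  · intro a ha hpos
    have h0 : α a ≠ 0 := by
      intro h
      have := hdeg a ha
      rw [h, zero_add] at this
      rcases mul_eq_zero.1 this with h' | h'
      · exact hpos.ne' (Nat.cast_eq_zero.1 h')
      · exact hβ h'
    obtain ⟨h1, h2, h3⟩ := hstep a ha h0
    refine ⟨h1, h2, hdeg_uniq _ _ ?_⟩
    have := hdeg (D a) h1
    rw [h3] at this
    push_cast
    linear_combination this - hdeg a ha

/-- Iterated form of the last conclusion of `IsLND.exists_degree_function`. -/
theorem iterate_degree_function {v : Valuation A Γ₀} {D : A → A} {a₀ : A} {deg : A → ℕ}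
    (hdeg : ∀ a, a ≠ 0 → 0 < deg a →
      D a ≠ 0 ∧ v (D a) * v a₀ = v (D a₀) * v a ∧ deg (D a) + 1 = deg a)
    {a : A} (ha : a ≠ 0) (t : ℕ) (ht : t ≤ deg a) :
    D^[t] a ≠ 0 ∧ v (D^[t] a) * v a₀ ^ t = v (D a₀) ^ t * v a ∧ deg (D^[t] a) + t = deg a := by
  induction t with
  | zero => exact ⟨ha, by simp, rfl⟩
  | succ t ih =>
    obtain ⟨h1, h2, h3⟩ := ih (by omega)
    obtain ⟨h4, h5, h6⟩ := hdeg _ h1 (by omega)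
    rw [Function.iterate_succ_apply']
    refine ⟨h4, ?_, by omega⟩
    rw [pow_succ', pow_succ', ← mul_assoc, h5, mul_assoc, h2, mul_assoc]

end LeadingDerivation

section DegreeModel

open Polynomial

/-- The element `Tⁱ` of `k((T))`. -/
noncomputable abbrev tpow (k : Type*) [Field k] (i : ℤ) : LaurentSeries k :=
  HahnSeries.single i 1

/-- A realization of `A` as a subalgebra of `k((T))[S]` containing `T` and `S`, with a
`k[T]`-basis having one element of each degree `J`, whose leading coefficient is
`T ^ (-w J)`. -/
structure DegreeModel (k A : Type*) [Field k] [CommRing A] [Algebra k A] where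
  /-- The realization. -/
  ι : A →ₐ[k] (LaurentSeries k)[X]
  /-- The element realized as `T`. -/
  x : A
  /-- The basis. -/
  b : ℕ → A
  /-- The pole orders of the leading coefficients. -/
  w : ℕ → ℕ
  ι_x : ι x = Polynomial.C (tpow k 1)
  b_zero : b 0 = 1
  ι_b_one : ι (b 1) = Polynomial.X
  natDegree_b : ∀ J, (ι (b J)).natDegree = J
  leadingCoeff_b : ∀ J, (ι (b J)).leadingCoeff = tpow k (-(w J : ℤ))
  span : ∀ a, ∃ (N : ℕ) (c : ℕ → k[X]), a = ∑ J ∈ Finset.range N, Polynomial.aeval x (c J) * b J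
  clear_denominators : ∀ a, ∃ N : ℕ, x ^ N * a ∈ Algebra.adjoin k {x, b 1}

namespace DegreeModel

variable {k A : Type*} [Field k] [CommRing A] [Algebra k A] (M : DegreeModel k A)

/-- Transport of a model along an isomorphism. -/
noncomputable def transport {A' : Type*} [CommRing A'] [Algebra k A'] (φ : A ≃ₐ[k] A') :
    DegreeModel k A' where
  ι := M.ι.comp φ.symm
  x := φ M.x
  b J := φ (M.b J)
  w := M.w
  ι_x := by simp [M.ι_x]
  b_zero := by simp [M.b_zero]
  ι_b_one := by simp [M.ι_b_one]
  natDegree_b J := by simp [M.natDegree_b]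
  leadingCoeff_b J := by simp [M.leadingCoeff_b]
  span a := by
    obtain ⟨N, c, h⟩ := M.span (φ.symm a)
    refine ⟨N, c, ?_⟩
    rw [← φ.apply_symm_apply a, h, map_sum]
    simp [Polynomial.aeval_algEquiv]
  clear_denominators a := by
    obtain ⟨N, h⟩ := M.clear_denominators (φ.symm a)
    refine ⟨N, ?_⟩
    have := Subalgebra.mem_map.2 ⟨_, h, (rfl : (φ : A →ₐ[k] A') _ = _)⟩
    rw [AlgHom.map_adjoin] at this
    simpa [Set.image_pair] using this

theorem ι_add (a a' : A) : M.ι (a + a') = M.ι a + M.ι a' := M.ι.toRingHom.map_add a a'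

theorem b_ne_zero (J : ℕ) : M.ι (M.b J) ≠ 0 := by
  rw [← leadingCoeff_ne_zero, M.leadingCoeff_b]
  exact HahnSeries.single_ne_zero one_ne_zero

theorem w_one : M.w 1 = 0 := by
  have h := M.leadingCoeff_b 1
  rw [M.ι_b_one, leadingCoeff_X] at h
  have := congrArg HahnSeries.order h
  rw [HahnSeries.order_one, HahnSeries.order_single one_ne_zero] at this
  omega

theorem ι_aeval (c : k[X]) :
    M.ι (Polynomial.aeval M.x c) = Polynomial.C (Polynomial.aeval (tpow k 1) c) := by
  rw [← Polynomial.aeval_algHom_apply, M.ι_x]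
  exact Polynomial.aeval_algHom_apply (Polynomial.CAlgHom (R := k) (A := LaurentSeries k)) _ c

/-- The valuation on `A` induced by `lexValuation`. -/
noncomputable def val : Valuation A LexValueGroup := lexValuation.comap M.ι.toRingHom

theorem val_apply (a : A) : M.val a = lexValuation (M.ι a) := rfl

theorem val_algebraMap {c : k} (hc : c ≠ 0) : M.val (algebraMap k A c) = 1 := by
  rw [val_apply, AlgHom.commutes, lexValuation_algebraMap hc]

theorem val_x : M.val M.x = WithZero.exp (toLex ((0 : ℤ), (-1 : ℤ))) := by
  rw [val_apply, M.ι_x, lexValuation_of_ne_zero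
    (Polynomial.C_ne_zero.2 (HahnSeries.single_ne_zero one_ne_zero))]
  simp [HahnSeries.order_single]

theorem val_b (J : ℕ) : M.val (M.b J) = WithZero.exp (toLex ((J : ℤ), (M.w J : ℤ))) := by
  rw [val_apply, lexValuation_of_ne_zero (M.b_ne_zero J), M.natDegree_b, M.leadingCoeff_b,
    HahnSeries.order_single one_ne_zero, neg_neg]

theorem val_x_lt_one : M.val M.x < 1 := by
  rw [val_x, ← WithZero.exp_zero, WithZero.exp_lt_exp, ← toLex_zero, Prod.Lex.toLex_lt_toLex]
  right
  simp

theorem val_algebraMap_le (c : k) : M.val (algebraMap k A c) ≤ 1 := by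
  by_cases h : c = 0
  · simp [h]
  · exact (M.val_algebraMap h).le

theorem val_aeval_le_one (c : k[X]) : M.val (Polynomial.aeval M.x c) ≤ 1 := by
  rw [Polynomial.aeval_eq_sum_range]
  refine Valuation.map_sum_le _ fun i _ => ?_
  rw [Algebra.smul_def, map_mul, map_pow]
  exact mul_le_one' (M.val_algebraMap_le _) (pow_le_one' M.val_x_lt_one.le i)

theorem val_aeval_add (c : k[X]) (r : k) (hr : r ≠ 0) :
    M.val (Polynomial.aeval M.x (c * Polynomial.X + Polynomial.C r)) = 1 ∧
      M.val (Polynomial.aeval M.x (c * Polynomial.X)) < 1 := by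
  have h : M.val (Polynomial.aeval M.x (c * Polynomial.X)) < 1 := by
    rw [map_mul, Polynomial.aeval_X, map_mul]
    exact (mul_le_of_le_one_left' (M.val_aeval_le_one c)).trans_lt M.val_x_lt_one
  refine ⟨?_, h⟩
  rw [map_add, Polynomial.aeval_C, Valuation.map_add_eq_of_lt_right, M.val_algebraMap hr]
  rwa [M.val_algebraMap hr]

theorem exists_val_aeval {c : k[X]} (hc : c ≠ 0) :
    ∃ i : ℕ, M.val (Polynomial.aeval M.x c) = M.val M.x ^ i := by
  obtain ⟨i, c, rfl, h⟩ : ∃ (i : ℕ) (c' : k[X]), c = c' * Polynomial.X ^ i ∧ c'.coeff 0 ≠ 0 := by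
    obtain ⟨c', h1, h2⟩ := Polynomial.exists_eq_pow_rootMultiplicity_mul_and_not_dvd c hc 0
    rw [Polynomial.C_0, sub_zero] at h1 h2
    exact ⟨_, c', by rw [mul_comm]; exact h1, fun h => h2 (Polynomial.X_dvd_iff.2 h)⟩
  refine ⟨i, ?_⟩
  rw [map_mul, map_pow, Polynomial.aeval_X, map_mul, map_pow, ← Polynomial.divX_mul_X_add c,
    (M.val_aeval_add _ _ h).1, one_mul]

theorem aeval_ne_zero {c : k[X]} (hc : c ≠ 0) : Polynomial.aeval M.x c ≠ 0 := by
  obtain ⟨i, hi⟩ := M.exists_val_aeval hc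
  intro h
  rw [h, map_zero] at hi
  refine pow_ne_zero i ?_ hi.symm
  rw [val_x]
  exact WithZero.exp_ne_zero

theorem aeval_injective : Function.Injective (Polynomial.aeval (R := k) M.x) := by
  refine (injective_iff_map_eq_zero _).2 fun c hc => ?_
  by_contra h
  exact M.aeval_ne_zero h hc

theorem aeval_tpow_ne_zero (M : DegreeModel k A) {c : k[X]} (hc : c ≠ 0) :
    Polynomial.aeval (tpow k 1) c ≠ 0 := by
  obtain ⟨i, hi⟩ := M.exists_val_aeval hc
  intro h
  rw [val_apply, ι_aeval, h, Polynomial.C_0, map_zero] at hi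
  refine pow_ne_zero i ?_ hi.symm
  rw [val_x]
  exact WithZero.exp_ne_zero

theorem natDegree_ι_term {c : k[X]} (hc : c ≠ 0) (J : ℕ) :
    (M.ι (Polynomial.aeval M.x c * M.b J)).natDegree = J := by
  rw [map_mul, ι_aeval, Polynomial.natDegree_C_mul (M.aeval_tpow_ne_zero hc), M.natDegree_b]

theorem leadingCoeff_ι_term (c : k[X]) (J : ℕ) :
    (M.ι (Polynomial.aeval M.x c * M.b J)).leadingCoeff =
      Polynomial.aeval (tpow k 1) c * tpow k (-(M.w J : ℤ)) := by
  rw [map_mul, ι_aeval, leadingCoeff_mul, leadingCoeff_C, M.leadingCoeff_b]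

theorem term_ne_zero {c : k[X]} (hc : c ≠ 0) (J : ℕ) :
    M.ι (Polynomial.aeval M.x c * M.b J) ≠ 0 := by
  rw [map_mul, ι_aeval]
  exact mul_ne_zero (Polynomial.C_ne_zero.2 (M.aeval_tpow_ne_zero hc)) (M.b_ne_zero J)

theorem degree_ι_sum_lt (N : ℕ) (c : ℕ → k[X]) :
    (M.ι (∑ J ∈ Finset.range N, Polynomial.aeval M.x (c J) * M.b J)).degree < N := by
  rw [map_sum]
  refine (Polynomial.degree_sum_le _ _).trans_lt ?_
  refine (Finset.sup_lt_iff (WithBot.bot_lt_coe N)).2 fun J hJ => ?_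
  rw [map_mul, ι_aeval]
  refine Polynomial.degree_le_natDegree.trans_lt (Nat.cast_lt.2 ?_)
  refine (Polynomial.natDegree_C_mul_le _ _).trans_lt ?_
  rw [M.natDegree_b]
  exact Finset.mem_range.1 hJ

/-- Every nonzero element is a leading term plus an element of smaller degree. -/
theorem exists_leading_term {a : A} (ha : a ≠ 0) :
    ∃ (J : ℕ) (c : k[X]) (r : A), c ≠ 0 ∧ a = Polynomial.aeval M.x c * M.b J + r ∧
      (M.ι r).degree < J := by
  obtain ⟨N, c, h⟩ := M.span a
  induction N with
  | zero => exact absurd (by simpa using h) ha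
  | succ N ih =>
    by_cases hc : c N = 0
    · exact ih (by rw [h, Finset.sum_range_succ, hc, map_zero, zero_mul, add_zero])
    · refine ⟨N, c N, _, hc, ?_, M.degree_ι_sum_lt N c⟩
      rw [h, Finset.sum_range_succ, add_comm]

theorem natDegree_ι_add {J : ℕ} {c : k[X]} {r : A} (hc : c ≠ 0) (hr : (M.ι r).degree < J) :
    (M.ι (Polynomial.aeval M.x c * M.b J + r)).natDegree = J ∧
    (M.ι (Polynomial.aeval M.x c * M.b J + r)).leadingCoeff =
      Polynomial.aeval (tpow k 1) c * tpow k (-(M.w J : ℤ)) := by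
  have h : (M.ι r).degree < (M.ι (Polynomial.aeval M.x c * M.b J)).degree := by
    rwa [Polynomial.degree_eq_natDegree (M.term_ne_zero hc J), M.natDegree_ι_term hc]
  rw [ι_add]
  constructor
  · rw [Polynomial.natDegree_eq_of_degree_eq (Polynomial.degree_add_eq_left_of_degree_lt h),
      M.natDegree_ι_term hc]
  · rw [Polynomial.leadingCoeff_add_of_degree_lt' h, leadingCoeff_ι_term]

theorem ι_injective : Function.Injective M.ι := by
  refine (injective_iff_map_eq_zero _).2 fun a ha => ?_
  by_contra h
  obtain ⟨J, c, r, hc, rfl, hr⟩ := M.exists_leading_term h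
  have := (M.natDegree_ι_add hc hr).2
  rw [ha, leadingCoeff_zero] at this
  exact mul_ne_zero (M.aeval_tpow_ne_zero hc) (HahnSeries.single_ne_zero one_ne_zero) this.symm

theorem val_eq_zero {a : A} (h : M.val a = 0) : a = 0 := by
  rw [val_apply, lexValuation_eq_zero_iff] at h
  exact M.ι_injective (h.trans (map_zero _).symm)

theorem isDomain (M : DegreeModel k A) : IsDomain A :=
  Function.Injective.isDomain M.ι.toRingHom M.ι_injective

theorem exists_val_sub_lt {a b : A} (hb : b ≠ 0) (h : M.val a = M.val b) :
    ∃ c : k, M.val (a - algebraMap k A c * b) < M.val b := by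
  obtain ⟨c, hc⟩ := exists_lexValuation_sub_lt (fun h => hb (M.ι_injective (by simpa using h))) h
  refine ⟨c, ?_⟩
  rw [val_apply, val_apply]
  simpa using hc

theorem val_lt_of_degree_lt {J : ℕ} {c : k[X]} {r : A} (hc : c ≠ 0) (hr : (M.ι r).degree < J) :
    M.val r < M.val (Polynomial.aeval M.x c * M.b J) := by
  rw [val_apply, val_apply, lexValuation_of_ne_zero (M.term_ne_zero hc J), M.natDegree_ι_term hc]
  by_cases h : M.ι r = 0
  · rw [h, map_zero]
    exact WithZero.exp_pos
  rw [lexValuation_of_ne_zero h, WithZero.exp_lt_exp, Prod.Lex.toLex_lt_toLex]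
  exact Or.inl (Nat.cast_lt.2 ((Polynomial.natDegree_lt_iff_degree_lt h).2 hr))

/-- Every nonzero value is the value of some `xⁱ b_J`. -/
theorem exists_val_eq {a : A} (ha : a ≠ 0) :
    ∃ i : ℕ, M.val a = M.val (M.x ^ i * M.b (M.ι a).natDegree) := by
  obtain ⟨J, c, r, hc, rfl, hr⟩ := M.exists_leading_term ha
  obtain ⟨i, hi⟩ := M.exists_val_aeval hc
  refine ⟨i, ?_⟩
  rw [(M.natDegree_ι_add hc hr).1, Valuation.map_add_eq_of_lt_left _ (M.val_lt_of_degree_lt hc hr),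
    map_mul, hi, map_mul, map_pow]

/-- Elements of degree zero are polynomials in `x`. -/
theorem exists_aeval_eq {a : A} (ha : (M.ι a).natDegree = 0) :
    ∃ c : k[X], a = Polynomial.aeval M.x c := by
  by_cases h : a = 0
  · exact ⟨0, by simp [h]⟩
  obtain ⟨J, c, r, hc, rfl, hr⟩ := M.exists_leading_term h
  rw [(M.natDegree_ι_add hc hr).1] at ha
  subst ha
  have hr0 : M.ι r = 0 := by
    rw [← Polynomial.degree_eq_bot]
    exact Nat.WithBot.lt_zero_iff.1 hr
  have hr0 : r = 0 := M.ι_injective (hr0.trans (map_zero _).symm)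
  exact ⟨c, by rw [hr0, M.b_zero, mul_one, add_zero]⟩

end DegreeModel

end DegreeModel

namespace DegreeModel

open Polynomial

variable {k A : Type*} [Field k] [CommRing A] [Algebra k A] (M : DegreeModel k A)

theorem ι_mul (a a' : A) : M.ι (a * a') = M.ι a * M.ι a' := M.ι.toRingHom.map_mul a a'

theorem x_ne_zero (M : DegreeModel k A) : M.x ≠ 0 := by
  have := M.aeval_ne_zero (c := Polynomial.X) Polynomial.X_ne_zero
  rwa [Polynomial.aeval_X] at this

theorem ι_x_pow (N : ℕ) : M.ι (M.x ^ N) = Polynomial.C (tpow k 1 ^ N) := by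
  rw [map_pow, M.ι_x, Polynomial.C_pow]

theorem ι_derivation {D : Derivation k A A} (hx : D M.x = 0) (a : A) :
    M.ι (D a) = derivative (M.ι a) * M.ι (D (M.b 1)) := by
  have hadj : ∀ a ∈ Algebra.adjoin k {M.x, M.b 1},
      M.ι (D a) = derivative (M.ι a) * M.ι (D (M.b 1)) := by
    intro a ha
    induction ha using Algebra.adjoin_induction with
    | mem a ha =>
      rcases ha with rfl | rfl
      · rw [hx, M.ι_x, map_zero, derivative_C, zero_mul]
      · rw [M.ι_b_one, derivative_X, one_mul]
    | algebraMap r =>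
      rw [Derivation.map_algebraMap, AlgHom.commutes, map_zero, Polynomial.algebraMap_apply,
        derivative_C, zero_mul]
    | add a b _ _ ha hb => rw [map_add D, ι_add, ι_add, ha, hb, derivative_add, add_mul]
    | mul a b _ _ ha hb =>
      rw [Derivation.leibniz, smul_eq_mul, smul_eq_mul, ι_add, ι_mul, ι_mul, ι_mul, ha, hb,
        derivative_mul]
      ring
  obtain ⟨N, hN⟩ := M.clear_denominators a
  have h := hadj _ hN
  rw [Derivation.leibniz, Derivation.leibniz_pow, hx, smul_zero, smul_zero, smul_zero, add_zero,
    smul_eq_mul, ι_mul, ι_mul, ι_x_pow, derivative_C_mul, mul_assoc] at h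
  exact mul_left_cancel₀ (Polynomial.C_ne_zero.2 (pow_ne_zero N
    (HahnSeries.single_ne_zero one_ne_zero))) h

variable [CharZero k]

instance charZero_laurentSeries : CharZero (LaurentSeries k) :=
  charZero_of_injective_algebraMap (algebraMap k (LaurentSeries k)).injective

theorem natDegree_ι_slope {D : Derivation k A A} (hD : IsLND D) (hx : D M.x = 0) (hD0 : D ≠ 0) :
    M.ι (D (M.b 1)) ≠ 0 ∧ (M.ι (D (M.b 1))).natDegree = 0 := by
  have hp : M.ι (D (M.b 1)) ≠ 0 := by
    intro h
    refine hD0 (Derivation.ext fun a => M.ι_injective ?_)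
    rw [M.ι_derivation hx, h, mul_zero, Derivation.zero_apply, map_zero]
  refine ⟨hp, ?_⟩
  by_contra hr
  have key : ∀ t : ℕ, 1 ≤ (M.ι ((⇑D)^[t] (M.b 1))).natDegree := by
    intro t
    induction t with
    | zero => exact (M.natDegree_b 1).ge
    | succ t ih =>
      rw [Function.iterate_succ_apply', M.ι_derivation hx]
      have h1 : derivative (M.ι ((⇑D)^[t] (M.b 1))) ≠ 0 := fun h => by
        have := Polynomial.derivative_eq_zero.1 h
        omega
      rw [natDegree_mul h1 hp]
      omega
  obtain ⟨n, hn⟩ := hD.exists_iterate_eq_zero (M.b 1)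
  have := key n
  rw [hn, map_zero, natDegree_zero] at this
  omega

theorem iterate_derivative_eq_C {K : Type*} [Field K] {p : K[X]} {J : ℕ} (h : p.natDegree ≤ J) :
    derivative^[J] p = Polynomial.C ((J.factorial : K) * p.coeff J) := by
  ext m
  rw [Polynomial.coeff_iterate_derivative, Polynomial.coeff_C]
  split_ifs with hm
  · rw [hm, zero_add, Nat.descFactorial_self, nsmul_eq_mul]
  · rw [Polynomial.coeff_eq_zero_of_natDegree_lt (by omega), smul_zero]

/-- The kernel of a locally nilpotent derivation `D` killing `x`, and the images under `D ^ J` of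
the kernel of `D ^ (J + 1)`. -/
theorem exists_slope {D : Derivation k A A} (hD : IsLND D) (hx : D M.x = 0) (hD0 : D ≠ 0) :
    ∃ p : k[X], p ≠ 0 ∧ (∀ a, D a = 0 → ∃ c : k[X], a = Polynomial.aeval M.x c) ∧
      (∀ J, (⇑D)^[J + 1] (M.b J) = 0 ∧
        (⇑D)^[J] (M.b J) * M.x ^ M.w J =
          Polynomial.aeval M.x (Polynomial.C (J.factorial : k) * p ^ J)) ∧
      ∀ J a, (⇑D)^[J + 1] a = 0 → ∃ c : k[X],
        (⇑D)^[J] a * M.x ^ M.w J = Polynomial.aeval M.x (c * p ^ J) := by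
  obtain ⟨hne, hdeg⟩ := M.natDegree_ι_slope hD hx hD0
  obtain ⟨p, hp⟩ := M.exists_aeval_eq hdeg
  have hp0 : p ≠ 0 := by
    rintro rfl
    rw [hp, map_zero, map_zero] at hne
    exact hne rfl
  set π := Polynomial.aeval (tpow k 1) p
  have hπ : M.ι (D (M.b 1)) = Polynomial.C π := by rw [hp, ι_aeval]
  have hπ0 : π ≠ 0 := M.aeval_tpow_ne_zero hp0
  have hder : ∀ a, M.ι (D a) = derivative (M.ι a) * Polynomial.C π := fun a => by
    rw [M.ι_derivation hx, hπ]
  have hiter : ∀ t a, M.ι ((⇑D)^[t] a) = derivative^[t] (M.ι a) * Polynomial.C (π ^ t) := by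
    intro t a
    induction t with
    | zero => simp
    | succ t ih =>
      rw [Function.iterate_succ_apply', hder, ih, derivative_mul, derivative_C, mul_zero,
        add_zero, Function.iterate_succ_apply', pow_succ, Polynomial.C_mul, mul_assoc]
  have hker : ∀ J a, (⇑D)^[J + 1] a = 0 → (M.ι a).natDegree ≤ J := by
    intro J a h
    have h1 := hiter (J + 1) a
    rw [h, map_zero, eq_comm, mul_eq_zero, Polynomial.C_eq_zero,
      or_iff_left (pow_ne_zero _ hπ0)] at h1
    by_contra hlt
    have h2 := congrArg (fun q => q.coeff ((M.ι a).natDegree - (J + 1))) h1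
    simp only [Polynomial.coeff_iterate_derivative, Polynomial.coeff_zero] at h2
    rw [Nat.sub_add_cancel (by omega), nsmul_eq_mul, mul_eq_zero, Nat.cast_eq_zero,
      Nat.descFactorial_eq_zero_iff_lt, coeff_natDegree, leadingCoeff_eq_zero] at h2
    rcases h2 with h2 | h2
    · omega
    · rw [h2, natDegree_zero] at hlt
      omega
  have htop : ∀ J a, (M.ι a).natDegree ≤ J → M.ι ((⇑D)^[J] a * M.x ^ M.w J) =
      Polynomial.C (J.factorial * ((M.ι a).coeff J * tpow k 1 ^ M.w J) * π ^ J) := by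
    intro J a h
    rw [ι_mul, hiter, iterate_derivative_eq_C h, ι_x_pow, ← Polynomial.C_mul, ← Polynomial.C_mul]
    congr 1
    ring
  have htpow : ∀ N : ℕ, tpow k (-(N : ℤ)) * tpow k 1 ^ N = 1 := by
    intro N
    rw [HahnSeries.single_pow, HahnSeries.single_mul_single]
    simp
  refine ⟨p, hp0, fun a ha => M.exists_aeval_eq (Nat.le_zero.1 (hker 0 a ha)), fun J => ⟨?_, ?_⟩,
    fun J a h => ?_⟩
  · refine M.ι_injective ?_
    rw [hiter, iterate_derivative_eq_zero (by rw [M.natDegree_b]; omega), zero_mul, map_zero]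
  · refine M.ι_injective ?_
    have hc : (M.ι (M.b J)).coeff J = tpow k (-(M.w J : ℤ)) := by
      rw [← M.leadingCoeff_b J, leadingCoeff, M.natDegree_b]
    rw [htop J _ (M.natDegree_b J).le, ι_aeval, hc, htpow]
    congr 1
    rw [map_mul, map_pow, Polynomial.aeval_C, map_natCast, mul_one]
  · have hJ := hker J a h
    obtain ⟨c, hc⟩ : ∃ c : k[X], (M.ι a).coeff J * tpow k 1 ^ M.w J =
        Polynomial.aeval (tpow k 1) c := by
      rcases hJ.lt_or_eq with hlt | heq
      · exact ⟨0, by rw [Polynomial.coeff_eq_zero_of_natDegree_lt hlt, zero_mul, map_zero]⟩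
      by_cases ha : a = 0
      · exact ⟨0, by rw [ha, map_zero, map_zero, Polynomial.coeff_zero, zero_mul]⟩
      obtain ⟨I, c, r, hc, rfl, hr⟩ := M.exists_leading_term ha
      obtain ⟨h1, h2⟩ := M.natDegree_ι_add hc hr
      refine ⟨c, ?_⟩
      rw [h1] at heq
      subst heq
      rw [leadingCoeff, h1] at h2
      rw [h2, mul_assoc, htpow, mul_one]
    refine ⟨Polynomial.C (J.factorial : k) * c, M.ι_injective ?_⟩
    rw [htop J a hJ, ι_aeval, hc]
    congr 1
    rw [map_mul, map_mul, map_pow, Polynomial.aeval_C, map_natCast]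

/-- Two models sharing the kernel of a nonzero locally nilpotent derivation have proportional
pole orders. -/
theorem exists_w_eq_mul (M M' : DegreeModel k A) {D : Derivation k A A} (hD : IsLND D)
    (hD0 : D ≠ 0) (hx : D M.x = 0) (hx' : D M'.x = 0) :
    ∃ N : ℕ, ∀ J, M.w J = N * M'.w J := by
  have := M.isDomain
  obtain ⟨p, hp0, hker, hb, him⟩ := M.exists_slope hD hx hD0
  obtain ⟨p', hp0', -, hb', him'⟩ := M'.exists_slope hD hx' hD0
  obtain ⟨q, hq⟩ := hker _ hx'
  have hq0 : q ≠ 0 := by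
    rintro rfl
    exact M'.x_ne_zero (by rw [hq, map_zero])
  have hcomp : ∀ c : k[X], Polynomial.aeval M'.x c = Polynomial.aeval M.x (c.comp q) := fun c => by
    rw [Polynomial.aeval_comp, hq]
  have hpq0 : p'.comp q ≠ 0 := by
    intro h
    refine M'.aeval_ne_zero hp0' ?_
    rw [hcomp, h, map_zero]
  have hfac : ∀ J : ℕ, (Polynomial.C (J.factorial : k)) ≠ 0 := fun J =>
    Polynomial.C_ne_zero.2 (Nat.cast_ne_zero.2 J.factorial_ne_zero)
  have hle : ∀ J, J * (p'.comp q).natDegree + M.w J ≤ J * p.natDegree + M'.w J * q.natDegree := by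
    intro J
    obtain ⟨h1, h2⟩ := hb J
    obtain ⟨c, hc⟩ := him' J _ h1
    rw [hcomp] at hc
    have h3 : Polynomial.C (J.factorial : k) * p ^ J * q ^ M'.w J =
        (c * p' ^ J).comp q * Polynomial.X ^ M.w J := by
      refine M.aeval_injective ?_
      rw [map_mul, map_mul (Polynomial.aeval M.x) (Polynomial.comp _ _), ← h2, ← hc, map_pow,
        map_pow, Polynomial.aeval_X, ← hq]
      ring
    have h4 : Polynomial.C (J.factorial : k) * p ^ J * q ^ M'.w J ≠ 0 :=
      mul_ne_zero (mul_ne_zero (hfac J) (pow_ne_zero _ hp0)) (pow_ne_zero _ hq0)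
    have h5 : (p'.comp q) ^ J * Polynomial.X ^ M.w J ∣
        Polynomial.C (J.factorial : k) * p ^ J * q ^ M'.w J := by
      refine ⟨c.comp q, ?_⟩
      rw [h3, Polynomial.mul_comp, Polynomial.pow_comp]
      ring
    have h6 := Polynomial.natDegree_le_of_dvd h5 h4
    rwa [natDegree_mul (pow_ne_zero _ hpq0) (pow_ne_zero _ Polynomial.X_ne_zero), natDegree_pow,
      natDegree_X_pow, natDegree_mul (mul_ne_zero (hfac J) (pow_ne_zero _ hp0))
      (pow_ne_zero _ hq0), natDegree_mul (hfac J) (pow_ne_zero _ hp0), natDegree_C, zero_add,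
      natDegree_pow, natDegree_pow] at h6
  have hge : ∀ J, J * p.natDegree + M'.w J * q.natDegree ≤ J * (p'.comp q).natDegree + M.w J := by
    intro J
    obtain ⟨h1, h2⟩ := hb' J
    obtain ⟨c, hc⟩ := him J _ h1
    rw [hcomp] at h2
    have h3 : (Polynomial.C (J.factorial : k) * p' ^ J).comp q * Polynomial.X ^ M.w J =
        c * p ^ J * q ^ M'.w J := by
      refine M.aeval_injective ?_
      rw [map_mul, map_mul (Polynomial.aeval M.x) (c * p ^ J), ← h2, ← hc, map_pow,
        map_pow, Polynomial.aeval_X, ← hq]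
      ring
    rw [Polynomial.mul_comp, Polynomial.pow_comp, Polynomial.C_comp] at h3
    have h4 : Polynomial.C (J.factorial : k) * (p'.comp q) ^ J * Polynomial.X ^ M.w J ≠ 0 :=
      mul_ne_zero (mul_ne_zero (hfac J) (pow_ne_zero _ hpq0))
        (pow_ne_zero _ Polynomial.X_ne_zero)
    have h5 : p ^ J * q ^ M'.w J ∣
        Polynomial.C (J.factorial : k) * (p'.comp q) ^ J * Polynomial.X ^ M.w J := by
      refine ⟨c, ?_⟩
      rw [h3]
      ring
    have h6 := Polynomial.natDegree_le_of_dvd h5 h4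
    rwa [natDegree_mul (pow_ne_zero _ hp0) (pow_ne_zero _ hq0), natDegree_pow, natDegree_pow,
      natDegree_mul (mul_ne_zero (hfac J) (pow_ne_zero _ hpq0))
      (pow_ne_zero _ Polynomial.X_ne_zero), natDegree_mul (hfac J) (pow_ne_zero _ hpq0),
      natDegree_C, zero_add, natDegree_pow, natDegree_X_pow] at h6
  have h1 : p.natDegree = (p'.comp q).natDegree := by
    have h2 := hle 1
    have h3 := hge 1
    rw [M.w_one, M'.w_one, zero_mul] at h2 h3
    omega
  refine ⟨q.natDegree, fun J => ?_⟩
  have h2 := hle J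
  have h3 := hge J
  rw [h1] at h2 h3
  rw [mul_comm]
  omega

end DegreeModel

namespace DegreeModel

open Polynomial

variable {k A : Type*} [Field k] [CommRing A] [Algebra k A] (M : DegreeModel k A)

theorem val_pos {a : A} (ha : a ≠ 0) : 0 < M.val a :=
  zero_lt_iff.2 fun h => ha (M.val_eq_zero h)

/-- The multiplicative shift of values by a derivation is maximal at one of the generators. -/
theorem exists_max_shift (y z : A) (hy : y ≠ 0) (hz : z ≠ 0)
    (hb : ∀ J, ∃ j p q : ℕ, M.b J = M.b 1 ^ j * y ^ p * z ^ q)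
    {D : Derivation k A A} (hx : D M.x ≠ 0) :
    ∃ a₀ : A, (a₀ = M.x ∨ a₀ = M.b 1 ∨ a₀ = y ∨ a₀ = z) ∧ D a₀ ≠ 0 ∧
      ∀ a, M.val (D a) * M.val a₀ ≤ M.val (D a₀) * M.val a := by
  have hs : M.b 1 ≠ 0 := fun h => M.b_ne_zero 1 (by rw [h, map_zero])
  classical
  obtain ⟨a₀, ha₀, hmax⟩ := Finset.exists_max_image ({M.x, M.b 1, y, z} : Finset A)
    (fun a => M.val (D a) / M.val a) ⟨M.x, by simp⟩
  simp only [Finset.mem_insert, Finset.mem_singleton] at ha₀ hmax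
  have hne : ∀ a, (a = M.x ∨ a = M.b 1 ∨ a = y ∨ a = z) → a ≠ 0 := by
    rintro a (rfl | rfl | rfl | rfl)
    exacts [M.x_ne_zero, hs, hy, hz]
  have ha₀' := M.val_pos (hne _ ha₀)
  have hgen : ∀ a, (a = M.x ∨ a = M.b 1 ∨ a = y ∨ a = z) →
      M.val (D a) * M.val a₀ ≤ M.val (D a₀) * M.val a := fun a ha => by
    have := hmax a ha
    rwa [div_le_div_iff₀ (M.val_pos (hne a ha)) ha₀'] at this
  have hDa₀ : D a₀ ≠ 0 := by
    intro h
    have := hgen M.x (Or.inl rfl)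
    rw [h, map_zero, zero_mul] at this
    exact (mul_pos (M.val_pos hx) ha₀').not_ge this
  refine ⟨a₀, ha₀, hDa₀, ?_⟩
  set Pr : A → Prop := fun a => M.val (D a) * M.val a₀ ≤ M.val (D a₀) * M.val a with hPr
  have hconst : ∀ c : k, Pr (algebraMap k A c) := fun c => by
    simp [hPr]
  have hmul : ∀ a b, Pr a → Pr b → Pr (a * b) := by
    intro a b ha hb
    simp only [hPr] at ha hb ⊢
    rw [Derivation.leibniz, smul_eq_mul, smul_eq_mul]
    refine (mul_le_mul_left (M.val.map_add _ _) _).trans ?_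
    rw [map_mul, map_mul, map_mul]
    rcases le_total (M.val a * M.val (D b)) (M.val b * M.val (D a)) with h | h
    · rw [max_eq_right h, mul_assoc, mul_comm (M.val a), mul_left_comm (M.val (D a₀))]
      exact mul_le_mul_right ha _
    · rw [max_eq_left h, mul_assoc, mul_left_comm (M.val (D a₀))]
      exact mul_le_mul_right hb _
  have hpow : ∀ a n, Pr a → Pr (a ^ n) := by
    intro a n ha
    induction n with
    | zero => simpa using hconst 1
    | succ n ih =>
      rw [pow_succ]
      exact hmul _ _ ih ha
  have hadd : ∀ a b, Pr a → Pr b → M.val a ≤ M.val (a + b) → M.val b ≤ M.val (a + b) →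
      Pr (a + b) := by
    intro a b ha hb h1 h2
    simp only [hPr] at ha hb ⊢
    rw [map_add]
    refine (mul_le_mul_left (M.val.map_add _ _) _).trans ?_
    rcases le_total (M.val (D a)) (M.val (D b)) with h | h
    · rw [max_eq_right h]
      exact hb.trans (mul_le_mul_right h2 _)
    · rw [max_eq_left h]
      exact ha.trans (mul_le_mul_right h1 _)
  have haeval : ∀ c : k[X], Pr (Polynomial.aeval M.x c) := by
    intro c
    induction c using Polynomial.recOnHorner with
    | M0 => simpa using hconst 0
    | MC p r hp hr ih =>
      obtain ⟨q, rfl⟩ := Polynomial.X_dvd_iff.2 hp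
      rw [mul_comm] at ih ⊢
      obtain ⟨h1, h2⟩ := M.val_aeval_add q r hr
      rw [map_add, Polynomial.aeval_C] at h1 ⊢
      refine hadd _ _ ih (hconst r) ?_ ?_
      · rw [h1]
        exact h2.le
      · rw [h1]
        exact M.val_algebraMap_le r
    | MX p hp ih =>
      rw [map_mul, Polynomial.aeval_X]
      exact hmul _ _ ih (hgen _ (Or.inl rfl))
  have hbasis : ∀ J, Pr (M.b J) := by
    intro J
    obtain ⟨j, p, q, h⟩ := hb J
    rw [h]
    exact hmul _ _ (hmul _ _ (hpow _ _ (hgen _ (by simp))) (hpow _ _ (hgen _ (by simp))))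
      (hpow _ _ (hgen _ (by simp)))
  have hall : ∀ (N : ℕ) (a : A), (M.ι a).degree < N → Pr a := by
    intro N
    induction N with
    | zero =>
      intro a ha
      have h0 : M.ι a = 0 := Polynomial.degree_eq_bot.1 (Nat.WithBot.lt_zero_iff.1 ha)
      have h0 : a = 0 := M.ι_injective (h0.trans (map_zero _).symm)
      rw [h0]
      simpa using hconst 0
    | succ N ih =>
      intro a ha
      by_cases h0 : a = 0
      · rw [h0]
        simpa using hconst 0
      obtain ⟨J, c, r, hc, rfl, hr⟩ := M.exists_leading_term h0
      have h1 := M.val_lt_of_degree_lt hc hr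
      have hJ : J < N + 1 := by
        rw [← (M.natDegree_ι_add hc hr).1]
        refine (Polynomial.natDegree_lt_iff_degree_lt ?_).2 ha
        exact fun h => h0 (M.ι_injective (h.trans (map_zero _).symm))
      have h2 := Valuation.map_add_eq_of_lt_left _ h1
      refine hadd _ _ (hmul _ _ (haeval c) (hbasis J))
        (ih r (hr.trans_le (Nat.cast_le.2 (by omega)))) h2.ge ?_
      rw [h2]
      exact h1.le
  exact fun a => hall ((M.ι a).natDegree + 1) a
    (Polynomial.degree_le_natDegree.trans_lt (Nat.cast_lt.2 (Nat.lt_succ_self _)))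

end DegreeModel

/-- The numerical obstruction: the leading part of a locally nilpotent derivation not killing `x`
would have degrees `A, C, Y, Z` at `x, s, y, z` and a shift of values `(V₁, V₂)`. -/
theorem not_exists_degrees {n e d m A C Y Z : ℕ} {V₁ V₂ : ℤ} (hn : 1 ≤ n) (he : 1 ≤ e)
    (hd : 2 ≤ d) (hm : 2 ≤ m) (hA : 0 < A) (h₁ : n * A + Y = d * C) (h₂ : e * A + Z = m * Y)
    (hx : ∀ t ≤ A, ∃ i j p q : ℕ, i * A + j * C + p * Y + q * Z + t = A ∧
      (j + d * p + d * m * q : ℤ) = t * V₁ ∧ (n * p + (n * m + e) * q - i : ℤ) = t * V₂ - 1)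
    (hs : ∀ t ≤ C, ∃ i j p q : ℕ, i * A + j * C + p * Y + q * Z + t = C ∧
      (j + d * p + d * m * q : ℤ) = t * V₁ + 1 ∧ (n * p + (n * m + e) * q - i : ℤ) = t * V₂)
    (hy : ∀ t ≤ Y, ∃ i j p q : ℕ, i * A + j * C + p * Y + q * Z + t = Y ∧
      (j + d * p + d * m * q : ℤ) = t * V₁ + d ∧
      (n * p + (n * m + e) * q - i : ℤ) = t * V₂ + n) : False := by
  have hY : 0 < Y := by
    rcases Nat.eq_zero_or_pos Y with h | h
    · subst h
      have := Nat.mul_pos he hA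
      omega
    · exact h
  have hC : 0 < C := by
    rcases Nat.eq_zero_or_pos C with h | h
    · subst h
      omega
    · exact h
  have hvan : ∀ i j p q : ℕ, i * A + j * C + p * Y + q * Z = 0 →
      i = 0 ∧ j = 0 ∧ p = 0 ∧ (q = 0 ∨ Z = 0) := by
    intro i j p q h
    simp only [add_eq_zero, mul_eq_zero] at h
    omega
  obtain ⟨ix, jx, px, qx, x1, x2, x3⟩ := hx A le_rfl
  obtain ⟨rfl, rfl, rfl, hqx⟩ := hvan ix jx px qx (by omega)
  obtain ⟨is, js, ps, qs, s1, s2, s3⟩ := hs C le_rfl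
  obtain ⟨rfl, rfl, rfl, hqs⟩ := hvan is js ps qs (by omega)
  obtain ⟨iy, jy, py, qy, y1, y2, y3⟩ := hy Y le_rfl
  obtain ⟨rfl, rfl, rfl, hqy⟩ := hvan iy jy py qy (by omega)
  push_cast at *
  rcases Nat.eq_zero_or_pos Z with hZ | hZ
  · subst hZ
    obtain ⟨i, j, p, q, h1, -, -⟩ := hx (A - 1) (by omega)
    have hone : i * A + j * C + p * Y = 1 := by omega
    have hcase : A = 1 ∨ C = 1 ∨ Y = 1 := by
      rcases Nat.eq_zero_or_pos i with rfl | hi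
      · rcases Nat.eq_zero_or_pos j with rfl | hj
        · right; right
          exact Nat.eq_one_of_mul_eq_one_left (m := p) (by simpa using hone)
        · have := Nat.le_mul_of_pos_left C hj
          omega
      · have := Nat.le_mul_of_pos_left A hi
        omega
    have hdvd : ¬ (d : ℤ) ∣ 1 := fun h => by
      have := Int.le_of_dvd one_pos h
      omega
    rcases hcase with rfl | rfl | rfl
    · refine hdvd ⟨m * qs - C * (m * qx), ?_⟩
      push_cast at x2
      linear_combination C * x2 - s2
    · have h : ((n * m + e : ℕ) : ℤ) ∣ n := ⟨qy - Y * qs, by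
        push_cast at s3 ⊢
        linear_combination Y * s3 - y3⟩
      have := Nat.le_of_dvd hn (Int.natCast_dvd_natCast.1 h)
      have := Nat.le_mul_of_pos_right n (show 0 < m by omega)
      omega
    · refine hdvd ⟨m * qs - C * (m * qy - 1), ?_⟩
      push_cast at y2
      linear_combination C * y2 - s2
  · have hqx : qx = 0 := by omega
    have hqs : qs = 0 := by omega
    subst hqx hqs
    have hV : (A : ℤ) * V₁ = 0 := by linear_combination -x2
    have hV : V₁ = 0 := (mul_eq_zero.1 hV).resolve_left (by omega)
    rw [hV] at s2
    simp at s2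

namespace DegreeModel

open Polynomial

variable {k A : Type*} [Field k] [CharZero k] [CommRing A] [Algebra k A] (M : DegreeModel k A)

/-- A rigidity property: if the basis consists of monomials in `s, y, z` with the given pole
orders, every locally nilpotent derivation with a nonconstant kernel element kills `x`. -/
theorem apply_x_eq_zero {n e d m : ℕ} (hn : 1 ≤ n) (he : 1 ≤ e) (hd : 2 ≤ d) (hm : 2 ≤ m)
    (hb : ∀ J, M.b J = M.b 1 ^ (J % d) * M.b d ^ (J / d % m) * M.b (d * m) ^ (J / (d * m)))
    (hw : ∀ J, M.w J = n * (J / d % m) + (n * m + e) * (J / (d * m)))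
    {D : Derivation k A A} (hD : IsLND D) {f : A} (hf : D f = 0)
    (hf' : ∀ c : k, f ≠ algebraMap k A c) : D M.x = 0 := by
  by_contra hx
  have := M.isDomain
  have hbne : ∀ J, M.b J ≠ 0 := fun J h => M.b_ne_zero J (by rw [h, map_zero])
  have hdm : d < d * m := by nlinarith
  have hwd : M.w d = n := by
    rw [hw, Nat.div_self (by omega), Nat.mod_eq_of_lt (by omega), Nat.div_eq_of_lt hdm]
    ring
  have hwdm : M.w (d * m) = n * m + e := by
    rw [hw, Nat.mul_div_cancel_left _ (by omega), Nat.mod_self, Nat.div_self (by omega)]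
    ring
  obtain ⟨a₀, ha₀, hDa₀, hmax⟩ := M.exists_max_shift (M.b d) (M.b (d * m)) (hbne _) (hbne _)
    (fun J => ⟨_, _, _, hb J⟩) hx
  obtain ⟨deg, hdmul, hdval, hpos, hdeg⟩ := hD.exists_degree_function
    (fun a => M.val_eq_zero) (fun c => M.val_algebraMap)
    (fun a b => M.exists_val_sub_lt) hDa₀ hmax
  have hd1 : deg 1 = 0 := by
    have := hdmul 1 1 one_ne_zero one_ne_zero
    rw [one_mul] at this
    omega
  have hdpow : ∀ a (N : ℕ), a ≠ 0 → deg (a ^ N) = N * deg a := by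
    intro a N ha
    induction N with
    | zero => rw [pow_zero, hd1, zero_mul]
    | succ N ih => rw [pow_succ, hdmul _ _ (pow_ne_zero N ha) ha, ih, Nat.succ_mul]
  have hrep : ∀ a, a ≠ 0 → ∃ i j p q : ℕ, (M.ι a).natDegree = j + d * p + d * m * q ∧
      M.val a = WithZero.exp (toLex ((j + d * p + d * m * q : ℤ),
        (n * p + (n * m + e) * q - i : ℤ))) ∧
      deg a = i * deg M.x + j * deg (M.b 1) + p * deg (M.b d) + q * deg (M.b (d * m)) := by
    intro a ha
    obtain ⟨i, hi⟩ := M.exists_val_eq ha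
    set J := (M.ι a).natDegree
    have hJ : J = J % d + d * (J / d % m) + d * m * (J / (d * m)) := by
      have h1 := Nat.mod_add_div J d
      have h2 := Nat.mod_add_div (J / d) m
      rw [Nat.div_div_eq_div_mul] at h2
      calc J = J % d + d * (J / d) := h1.symm
        _ = J % d + d * (J / d % m + m * (J / (d * m))) := by rw [h2]
        _ = _ := by ring
    refine ⟨i, J % d, J / d % m, J / (d * m), hJ, ?_, ?_⟩
    · rw [hi, map_mul, map_pow, M.val_x, M.val_b, ← WithZero.exp_nsmul, ← WithZero.exp_add, hw]
      congr 1
      refine toLex.symm.injective (Prod.ext ?_ ?_)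
      · simp
        exact_mod_cast hJ
      · simp
        ring
    · have hxi : M.x ^ i ≠ 0 := pow_ne_zero _ M.x_ne_zero
      rw [hdval _ _ ha (mul_ne_zero hxi (hbne J)) hi, hdmul _ _ hxi (hbne J), hb J,
        hdmul _ _ (mul_ne_zero (pow_ne_zero _ (hbne _)) (pow_ne_zero _ (hbne _)))
          (pow_ne_zero _ (hbne _)),
        hdmul _ _ (pow_ne_zero _ (hbne _)) (pow_ne_zero _ (hbne _)),
        hdpow _ _ M.x_ne_zero, hdpow _ _ (hbne _), hdpow _ _ (hbne _), hdpow _ _ (hbne _)]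
      ring
  have h₁ : n * deg M.x + deg (M.b d) = d * deg (M.b 1) := by
    rw [← hdpow _ _ M.x_ne_zero, ← hdpow _ _ (hbne 1),
      ← hdmul _ _ (pow_ne_zero _ M.x_ne_zero) (hbne d)]
    refine hdval _ _ (mul_ne_zero (pow_ne_zero _ M.x_ne_zero) (hbne d))
      (pow_ne_zero _ (hbne 1)) ?_
    rw [map_mul, map_pow, map_pow, M.val_x, M.val_b, M.val_b, ← WithZero.exp_nsmul,
      ← WithZero.exp_nsmul, ← WithZero.exp_add, hwd, M.w_one]
    congr 1
    refine toLex.symm.injective (Prod.ext ?_ ?_) <;> simp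
  have h₂ : e * deg M.x + deg (M.b (d * m)) = m * deg (M.b d) := by
    rw [← hdpow _ _ M.x_ne_zero, ← hdpow _ _ (hbne d),
      ← hdmul _ _ (pow_ne_zero _ M.x_ne_zero) (hbne _)]
    refine hdval _ _ (mul_ne_zero (pow_ne_zero _ M.x_ne_zero) (hbne _))
      (pow_ne_zero _ (hbne d)) ?_
    rw [map_mul, map_pow, map_pow, M.val_x, M.val_b, M.val_b, ← WithZero.exp_nsmul,
      ← WithZero.exp_nsmul, ← WithZero.exp_add, hwd, hwdm]
    congr 1
    refine toLex.symm.injective (Prod.ext ?_ ?_) <;> simp <;> ring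
  obtain ⟨α, hα⟩ : ∃ α, M.val a₀ = WithZero.exp α :=
    ⟨_, (WithZero.exp_log (M.val_pos (by rintro rfl; exact hDa₀ (map_zero D))).ne').symm⟩
  obtain ⟨β, hβ⟩ : ∃ β, M.val (D a₀) = WithZero.exp β :=
    ⟨_, (WithZero.exp_log (M.val_pos hDa₀).ne').symm⟩
  set V₁ := (ofLex β).1 - (ofLex α).1
  set V₂ := (ofLex β).2 - (ofLex α).2
  have hiter : ∀ a (g₁ g₂ : ℤ), a ≠ 0 → M.val a = WithZero.exp (toLex (g₁, g₂)) → ∀ t ≤ deg a,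
      ∃ i j p q : ℕ,
        i * deg M.x + j * deg (M.b 1) + p * deg (M.b d) + q * deg (M.b (d * m)) + t = deg a ∧
        (j + d * p + d * m * q : ℤ) = t * V₁ + g₁ ∧
        (n * p + (n * m + e) * q - i : ℤ) = t * V₂ + g₂ := by
    intro a g₁ g₂ ha hg t ht
    obtain ⟨h3, h4, h5⟩ := iterate_degree_function hdeg ha t ht
    obtain ⟨i, j, p, q, -, h6, h7⟩ := hrep _ h3
    refine ⟨i, j, p, q, by omega, ?_⟩
    rw [h6, hα, hβ, hg, ← WithZero.exp_nsmul, ← WithZero.exp_nsmul, ← WithZero.exp_add,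
      ← WithZero.exp_add] at h4
    have h8 := congrArg ofLex (WithZero.exp_injective h4)
    have h9 := congrArg Prod.fst h8
    have h10 := congrArg Prod.snd h8
    simp at h9 h10
    constructor
    · linear_combination h9
    · linear_combination h10
  rcases Nat.eq_zero_or_pos (deg M.x) with hA | hA
  · rw [hA, mul_zero, zero_add] at h₁ h₂
    have hC : 0 < deg (M.b 1) := by
      rcases Nat.eq_zero_or_pos (deg (M.b 1)) with hC | hC
      · rw [hC, mul_zero] at h₁
        rw [h₁, mul_zero] at h₂
        rcases ha₀ with rfl | rfl | rfl | rfl <;> omega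
      · exact hC
    have hY : 0 < deg (M.b d) := by
      rw [h₁]
      exact Nat.mul_pos (by omega) hC
    have hZ : 0 < deg (M.b (d * m)) := by
      rw [h₂]
      exact Nat.mul_pos (by omega) hY
    have hf0 : f ≠ 0 := fun h => hf' 0 (by rw [h, map_zero])
    have hdf : deg f = 0 := by
      by_contra h
      exact (hdeg f hf0 (Nat.pos_of_ne_zero h)).1 hf
    obtain ⟨i, j, p, q, h3, -, h4⟩ := hrep f hf0
    rw [hdf, eq_comm] at h4
    simp only [add_eq_zero, mul_eq_zero] at h4
    obtain ⟨rfl, rfl, rfl⟩ : j = 0 ∧ p = 0 ∧ q = 0 := by omega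
    obtain ⟨c, rfl⟩ := M.exists_aeval_eq (by simpa using h3)
    rw [Derivation.map_aeval, smul_eq_mul, mul_eq_zero, or_iff_left hx] at hf
    have hc : derivative c = 0 := by
      by_contra h
      exact M.aeval_ne_zero h hf
    have hc := Polynomial.eq_C_of_natDegree_eq_zero (Polynomial.derivative_eq_zero.1 hc)
    refine hf' (c.coeff 0) ?_
    rw [hc, Polynomial.aeval_C]
    simp
  · refine not_exists_degrees hn he hd hm hA h₁ h₂ (V₁ := V₁) (V₂ := V₂) ?_ ?_ ?_
    · intro t ht
      simpa [sub_eq_add_neg] using hiter M.x 0 (-1) M.x_ne_zero M.val_x t ht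
    · intro t ht
      simpa using hiter (M.b 1) 1 0 (hbne 1) (by simpa [M.w_one] using M.val_b 1) t ht
    · intro t ht
      exact hiter (M.b d) d n (hbne d) (by simpa [hwd] using M.val_b d) t ht

end DegreeModel

section MonicEval

open Polynomial

/-- The value at `(x, t)` of the polynomial `T ^ d + f_{d-1}(X) T ^ (d-1) + ⋯ + f_0(X)`. -/
noncomputable def monicEval {k B : Type*} [Field k] [CommRing B] [Algebra k B] (d : ℕ)
    (f : ℕ → k[X]) (x t : B) : B :=
  t ^ d + ∑ i ∈ Finset.range d, Polynomial.aeval x (f i) * t ^ i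

variable {k B B' : Type*} [Field k] [CommRing B] [Algebra k B] [CommRing B'] [Algebra k B']

theorem map_monicEval (φ : B →ₐ[k] B') (d : ℕ) (f : ℕ → k[X]) (x t : B) :
    φ (monicEval d f x t) = monicEval d f (φ x) (φ t) := by
  simp [monicEval, Polynomial.aeval_algHom_apply]

theorem Pat_eq_monicEval [CharZero k] (d : ℕ) (f : ℕ → k[X]) (T : MvPolynomial (Fin 3) k) :
    Pat k d f T = monicEval d f (MvPolynomial.X 0) T := rfl

theorem Qpoly_eq_monicEval [CharZero k] (m : ℕ) (g : ℕ → k[X]) :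
    Qpoly k m g = monicEval m g (MvPolynomial.X 0) (MvPolynomial.X 1) := rfl

theorem monicEval_mem (S : Subalgebra k B) (d : ℕ) (f : ℕ → k[X]) {x t : B} (hx : x ∈ S)
    (ht : t ∈ S) : monicEval d f x t ∈ S := by
  refine add_mem (pow_mem ht d) (sum_mem fun i _ => mul_mem ?_ (pow_mem ht i))
  exact Polynomial.aeval_mem_adjoin_singleton k x |> Algebra.adjoin_le (by simpa using hx)

theorem natDegree_monicEval (d : ℕ) (f : ℕ → k[X]) (c : LaurentSeries k)
    {p : (LaurentSeries k)[X]} (hp : 0 < p.natDegree) :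
    (monicEval d f (Polynomial.C c) p).natDegree = d * p.natDegree ∧
      (monicEval d f (Polynomial.C c) p).leadingCoeff = p.leadingCoeff ^ d := by
  have hp0 : p ≠ 0 := by
    rintro rfl
    simp at hp
  have hlt : (∑ i ∈ Finset.range d, Polynomial.aeval (Polynomial.C c) (f i) * p ^ i).degree <
      (p ^ d).degree := by
    rw [Polynomial.degree_eq_natDegree (pow_ne_zero d hp0), natDegree_pow]
    refine (Polynomial.degree_sum_le _ _).trans_lt ?_
    refine (Finset.sup_lt_iff (WithBot.bot_lt_coe _)).2 fun i hi => ?_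
    have hC : Polynomial.aeval (Polynomial.C c) (f i) =
        Polynomial.C (Polynomial.aeval c (f i)) :=
      Polynomial.aeval_algHom_apply (Polynomial.CAlgHom (R := k) (A := LaurentSeries k)) c (f i)
    rw [hC]
    refine Polynomial.degree_le_natDegree.trans_lt (Nat.cast_lt.2 ?_)
    refine (Polynomial.natDegree_C_mul_le _ _).trans_lt ?_
    rw [natDegree_pow]
    exact Nat.mul_lt_mul_of_pos_right (Finset.mem_range.1 hi) hp
  unfold monicEval
  constructor
  · rw [Polynomial.natDegree_eq_of_degree_eq (Polynomial.degree_add_eq_left_of_degree_lt hlt),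
      natDegree_pow]
  · rw [Polynomial.leadingCoeff_add_of_degree_lt' hlt, leadingCoeff_pow]

end MonicEval

section Generators

variable {k A : Type*} [Field k] [CommRing A] [Algebra k A]

/-- The elements that a power of `x` multiplies into `S`. -/
def clearedSubalgebra (S : Subalgebra k A) {x : A} (hx : x ∈ S) : Subalgebra k A where
  carrier := {a | ∃ N : ℕ, x ^ N * a ∈ S}
  mul_mem' := by
    rintro a b ⟨N, ha⟩ ⟨N', hb⟩
    refine ⟨N + N', ?_⟩
    rw [pow_add, mul_mul_mul_comm]
    exact mul_mem ha hb
  add_mem' := by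
    rintro a b ⟨N, ha⟩ ⟨N', hb⟩
    refine ⟨N + N', ?_⟩
    have h : x ^ (N + N') * (a + b) = x ^ N' * (x ^ N * a) + x ^ N * (x ^ N' * b) := by ring
    rw [h]
    exact add_mem (mul_mem (pow_mem hx _) ha) (mul_mem (pow_mem hx _) hb)
  algebraMap_mem' r := ⟨0, by simp⟩

theorem mem_clearedSubalgebra_of_pow_mul_mem {S : Subalgebra k A} {x : A} (hx : x ∈ S) {N : ℕ}
    {a : A} (h : x ^ N * a ∈ clearedSubalgebra S hx) : a ∈ clearedSubalgebra S hx := by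
  obtain ⟨N', h⟩ := h
  exact ⟨N' + N, by rwa [pow_add, mul_assoc]⟩

theorem le_clearedSubalgebra {S : Subalgebra k A} {x : A} (hx : x ∈ S) :
    S ≤ clearedSubalgebra S hx := fun a ha => ⟨0, by simpa using ha⟩

theorem mem_span_range_of_mul_mem {x : A} {b : ℕ → A} {G : Set A}
    (hG : Algebra.adjoin k G = ⊤) (hb : b 0 = 1)
    (h : ∀ g ∈ G, ∀ J, g * b J ∈ Submodule.span (Algebra.adjoin k {x}) (Set.range b)) (a : A) :
    ∃ (N : ℕ) (c : ℕ → Polynomial k),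
      a = ∑ J ∈ Finset.range N, Polynomial.aeval x (c J) * b J := by
  set W := Submodule.span (Algebra.adjoin k {x}) (Set.range b)
  have hgen : ∀ g ∈ G, ∀ w ∈ W, g * w ∈ W := by
    intro g hg w hw
    induction hw using Submodule.span_induction with
    | mem w hw =>
      obtain ⟨J, rfl⟩ := hw
      exact h g hg J
    | zero => rw [mul_zero]; exact W.zero_mem
    | add u v _ _ hu hv => rw [mul_add]; exact W.add_mem hu hv
    | smul r u _ hu => rw [mul_smul_comm]; exact W.smul_mem r hu
  have hall : ∀ a : A, ∀ w ∈ W, a * w ∈ W := by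
    intro a
    have ha : a ∈ Algebra.adjoin k G := hG ▸ Algebra.mem_top
    induction ha using Algebra.adjoin_induction with
    | mem a ha => exact hgen a ha
    | algebraMap r =>
      intro w hw
      exact W.smul_mem (algebraMap k (Algebra.adjoin k {x}) r) hw
    | add u v _ _ hu hv =>
      intro w hw
      rw [add_mul]
      exact W.add_mem (hu w hw) (hv w hw)
    | mul u v _ _ hu hv =>
      intro w hw
      rw [mul_assoc]
      exact hu _ (hv w hw)
  have ha : a ∈ W := by
    have := hall a 1 (hb ▸ Submodule.subset_span ⟨0, rfl⟩)
    rwa [mul_one] at this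
  obtain ⟨c, hc⟩ := Finsupp.mem_span_range_iff_exists_finsupp.1 ha
  have hpoly : ∀ r : Algebra.adjoin k {x}, ∃ q : Polynomial k, Polynomial.aeval x q = (r : A) :=
    fun r => (Algebra.adjoin_singleton_eq_range_aeval k x).le r.2
  choose q hq using hpoly
  refine ⟨c.support.sup id + 1, fun J => q (c J), ?_⟩
  rw [← hc, Finsupp.sum_of_support_subset (s := Finset.range (c.support.sup id + 1)) _ ?_ _
    (by simp)]
  · refine Finset.sum_congr rfl fun J _ => ?_
    rw [hq]
    rfl
  · intro J hJ
    exact Finset.mem_range.2 (Nat.lt_succ_of_le (Finset.le_sup (f := id) hJ))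

theorem monicEval_sub_pow_mul_mem {x t u : A} (W : Submodule (Algebra.adjoin k {x}) A) {d : ℕ}
    (f : ℕ → Polynomial k) (h : ∀ i < d, t ^ i * u ∈ W) :
    (monicEval d f x t - t ^ d) * u ∈ W := by
  rw [monicEval, add_sub_cancel_left, Finset.sum_mul]
  refine W.sum_mem fun i hi => ?_
  rw [mul_assoc]
  exact W.smul_mem ⟨_, Polynomial.aeval_mem_adjoin_singleton k x⟩ (h i (Finset.mem_range.1 hi))

theorem monomial_mem_of_reduced_mem₂ {x s y : A} {n l : ℕ} (hl : 2 ≤ l) {h : ℕ → Polynomial k}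
    (hxy : x ^ n * y = monicEval l h x s) (W : Submodule (Algebra.adjoin k {x}) A)
    (hW : ∀ j q, j < l → s ^ j * y ^ q ∈ W) (j q : ℕ) : s ^ j * y ^ q ∈ W := by
  induction hN : 2 * j + 3 * q using Nat.strong_induction_on generalizing j q with
  | _ N ih =>
  by_cases hj : j < l
  · exact hW j q hj
  obtain ⟨i, rfl⟩ := Nat.exists_eq_add_of_le (not_lt.1 hj)
  have hrw : s ^ (l + i) * y ^ q =
      x ^ n * (s ^ i * y ^ (q + 1)) - (monicEval l h x s - s ^ l) * (s ^ i * y ^ q) := by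
    rw [← hxy]
    ring
  rw [hrw]
  refine W.sub_mem ?_ (monicEval_sub_pow_mul_mem W h fun t ht => ?_)
  · exact W.smul_mem ⟨_, pow_mem (Algebra.self_mem_adjoin_singleton k x) n⟩
      (ih _ (by omega) i (q + 1) rfl)
  · rw [← mul_assoc, ← pow_add]
    exact ih _ (by omega) _ _ rfl

theorem monomial_mem_of_reduced_mem₃ {x s y z : A} {n e d m : ℕ} (hd : 2 ≤ d) (hm : 2 ≤ m)
    {f g : ℕ → Polynomial k} (hxy : x ^ n * y = monicEval d f x s)
    (hyz : x ^ e * z = monicEval m g x y - s) (W : Submodule (Algebra.adjoin k {x}) A)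
    (hW : ∀ j p q, j < d → p < m → s ^ j * y ^ p * z ^ q ∈ W) (j p q : ℕ) :
    s ^ j * y ^ p * z ^ q ∈ W := by
  induction hN : 2 * j + 3 * p + 5 * q using Nat.strong_induction_on generalizing j p q with
  | _ N ih =>
  have hx : ∀ t : ℕ, x ^ t ∈ Algebra.adjoin k {x} := fun t =>
    pow_mem (Algebra.self_mem_adjoin_singleton k x) t
  by_cases hj : j < d
  · by_cases hp : p < m
    · exact hW j p q hj hp
    obtain ⟨i, rfl⟩ := Nat.exists_eq_add_of_le (not_lt.1 hp)
    have hrw : s ^ j * y ^ (m + i) * z ^ q =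
        x ^ e * (s ^ j * y ^ i * z ^ (q + 1)) + s ^ (j + 1) * y ^ i * z ^ q -
          (monicEval m g x y - y ^ m) * (s ^ j * y ^ i * z ^ q) := by
      have h1 : monicEval m g x y = x ^ e * z + s := by rw [hyz, sub_add_cancel]
      rw [h1]
      ring
    rw [hrw]
    refine W.sub_mem (W.add_mem ?_ (ih _ (by omega) _ _ _ rfl))
      (monicEval_sub_pow_mul_mem W g fun t ht => ?_)
    · exact W.smul_mem ⟨_, hx e⟩ (ih _ (by omega) _ _ _ rfl)
    · rw [mul_assoc, mul_left_comm, ← mul_assoc (y ^ t), ← pow_add, ← mul_assoc]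
      exact ih _ (by omega) _ _ _ rfl
  obtain ⟨i, rfl⟩ := Nat.exists_eq_add_of_le (not_lt.1 hj)
  have hrw : s ^ (d + i) * y ^ p * z ^ q =
      x ^ n * (s ^ i * y ^ (p + 1) * z ^ q) -
        (monicEval d f x s - s ^ d) * (s ^ i * y ^ p * z ^ q) := by
    rw [← hxy]
    ring
  rw [hrw]
  refine W.sub_mem ?_ (monicEval_sub_pow_mul_mem W f fun t ht => ?_)
  · exact W.smul_mem ⟨_, hx n⟩ (ih _ (by omega) _ _ _ rfl)
  · rw [mul_assoc, ← mul_assoc, ← pow_add, ← mul_assoc]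
    exact ih _ (by omega) _ _ _ rfl

end Generators

section Models

open Polynomial

variable {k A : Type*} [Field k] [CommRing A] [Algebra k A]

theorem natDegree_of_C_tpow_mul_eq {n : ℕ} {u p : (LaurentSeries k)[X]} {i : ℤ}
    (h : Polynomial.C (tpow k 1) ^ n * u = p) (hp : p.leadingCoeff = tpow k i) :
    u.natDegree = p.natDegree ∧ u.leadingCoeff = tpow k (i - n) := by
  have hpow : tpow k 1 ^ n = tpow k n := by
    rw [HahnSeries.single_pow]
    simp
  have hne : tpow k 1 ^ n ≠ 0 := pow_ne_zero n (HahnSeries.single_ne_zero one_ne_zero)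
  rw [← Polynomial.C_pow] at h
  subst h
  refine ⟨(Polynomial.natDegree_C_mul hne).symm, ?_⟩
  rw [leadingCoeff_mul, leadingCoeff_C] at hp
  refine mul_left_cancel₀ hne ?_
  rw [hp, hpow, HahnSeries.single_mul_single, mul_one, add_sub_cancel]

theorem tpow_pow (i : ℤ) (n : ℕ) : tpow k i ^ n = tpow k (n * i) := by
  rw [HahnSeries.single_pow]
  simp

variable (ι : A →ₐ[k] (LaurentSeries k)[X]) {x s y z : A}

theorem natDegree_ι_y {n d : ℕ} {f : ℕ → k[X]} (hx : ι x = Polynomial.C (tpow k 1))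
    (hs : ι s = Polynomial.X) (hxy : x ^ n * y = monicEval d f x s) :
    (ι y).natDegree = d ∧ (ι y).leadingCoeff = tpow k (-(n : ℤ)) := by
  have h := congrArg ι hxy
  rw [map_mul, map_pow, map_monicEval, hx, hs] at h
  obtain ⟨h1, h2⟩ := natDegree_monicEval d f (tpow k 1)
    (p := Polynomial.X) (by rw [natDegree_X]; exact one_pos)
  rw [leadingCoeff_X, one_pow] at h2
  obtain ⟨h3, h4⟩ := natDegree_of_C_tpow_mul_eq (i := 0) h h2
  rw [h3, h1, h4, natDegree_X, mul_one, zero_sub]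
  exact ⟨rfl, rfl⟩

theorem natDegree_ι_z {n e d m : ℕ} (hd : 2 ≤ d) (hm : 2 ≤ m) {f g : ℕ → k[X]}
    (hx : ι x = Polynomial.C (tpow k 1)) (hs : ι s = Polynomial.X)
    (hxy : x ^ n * y = monicEval d f x s) (hyz : x ^ e * z = monicEval m g x y - s) :
    (ι z).natDegree = d * m ∧ (ι z).leadingCoeff = tpow k (-((n * m + e : ℕ) : ℤ)) := by
  have h := congrArg ι hyz
  rw [map_mul, map_pow, map_sub, map_monicEval, hx, hs] at h
  obtain ⟨hy1, hy2⟩ := natDegree_ι_y ι hx hs hxy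
  obtain ⟨h1, h2⟩ := natDegree_monicEval m g (tpow k 1) (p := ι y) (by omega)
  rw [hy1] at h1
  rw [hy2, tpow_pow] at h2
  have hlt : (Polynomial.X : (LaurentSeries k)[X]).degree <
      (monicEval m g (Polynomial.C (tpow k 1)) (ι y)).degree := by
    refine Polynomial.degree_lt_degree ?_
    rw [natDegree_X, h1]
    nlinarith
  have h3 : (monicEval m g (Polynomial.C (tpow k 1)) (ι y) - Polynomial.X).leadingCoeff =
      tpow k (m * -(n : ℤ)) := by
    rw [Polynomial.leadingCoeff_sub_of_degree_lt hlt, h2]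
  obtain ⟨h4, h5⟩ := natDegree_of_C_tpow_mul_eq h h3
  rw [h4, Polynomial.natDegree_sub_eq_left_of_natDegree_lt
    (Polynomial.natDegree_lt_natDegree Polynomial.X_ne_zero hlt), h1, h5, mul_comm]
  refine ⟨rfl, ?_⟩
  refine congrArg (tpow k) ?_
  push_cast
  ring

/-- The model of a ring generated by `x, s, y` with `xⁿ y = F(x, s)`. -/
noncomputable def danielewskiModel {n l : ℕ} (hl : 2 ≤ l) {h : ℕ → k[X]}
    (hx : ι x = Polynomial.C (tpow k 1)) (hs : ι s = Polynomial.X)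
    (hxy : x ^ n * y = monicEval l h x s) (hgen : Algebra.adjoin k {x, s, y} = ⊤) :
    DegreeModel k A where
  ι := ι
  x := x
  b J := s ^ (J % l) * y ^ (J / l)
  w J := n * (J / l)
  ι_x := hx
  b_zero := by simp
  ι_b_one := by
    rw [Nat.mod_eq_of_lt (by omega), Nat.div_eq_of_lt (by omega), pow_one, pow_zero, mul_one, hs]
  natDegree_b J := by
    obtain ⟨h1, h2⟩ := natDegree_ι_y ι hx hs hxy
    have hy : ι y ≠ 0 := fun h0 => by
      rw [h0, natDegree_zero] at h1
      omega
    rw [map_mul, map_pow, map_pow, hs, natDegree_mul (pow_ne_zero _ Polynomial.X_ne_zero)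
      (pow_ne_zero _ hy), natDegree_X_pow, natDegree_pow, h1, mul_comm, Nat.mod_add_div]
  leadingCoeff_b J := by
    obtain ⟨h1, h2⟩ := natDegree_ι_y ι hx hs hxy
    rw [map_mul, map_pow, map_pow, hs, leadingCoeff_mul, leadingCoeff_X_pow, one_mul,
      leadingCoeff_pow, h2, tpow_pow]
    refine congrArg (tpow k) ?_
    push_cast
    ring
  span := by
    refine mem_span_range_of_mul_mem hgen (by simp) fun c hc J => ?_
    set W := Submodule.span (Algebra.adjoin k {x})
      (Set.range fun J => s ^ (J % l) * y ^ (J / l)) with hW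
    have hmon : ∀ j q, s ^ j * y ^ q ∈ W := by
      refine monomial_mem_of_reduced_mem₂ hl hxy W fun j q hj => ?_
      refine Submodule.subset_span ⟨j + l * q, ?_⟩
      simp only
      rw [Nat.add_mul_mod_self_left, Nat.mod_eq_of_lt hj, Nat.add_mul_div_left _ _ (by omega),
        Nat.div_eq_of_lt hj, zero_add]
    rcases hc with rfl | rfl | rfl
    · exact W.smul_mem ⟨_, Algebra.self_mem_adjoin_singleton k c⟩ (hmon _ _)
    · rw [← mul_assoc, ← pow_succ']
      exact hmon _ _
    · rw [mul_left_comm, ← pow_succ']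
      exact hmon _ _
  clear_denominators a := by
    rw [Nat.mod_eq_of_lt (by omega), Nat.div_eq_of_lt (by omega), pow_one, pow_zero, mul_one]
    have hx' : x ∈ Algebra.adjoin k {x, s} := Algebra.subset_adjoin (by simp)
    have hs' : s ∈ Algebra.adjoin k {x, s} := Algebra.subset_adjoin (by simp)
    have hle : Algebra.adjoin k {x, s, y} ≤ clearedSubalgebra _ hx' := by
      refine Algebra.adjoin_le ?_
      rintro c (rfl | rfl | rfl)
      · exact le_clearedSubalgebra hx' hx'
      · exact le_clearedSubalgebra hx' hs'
      · refine mem_clearedSubalgebra_of_pow_mul_mem hx' (N := n) ?_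
        rw [hxy]
        exact le_clearedSubalgebra hx' (monicEval_mem _ l h hx' hs')
    exact hle (hgen ▸ Algebra.mem_top)

/-- The model of a ring generated by `x, s, y, z` with `xⁿ y = P(x, s)` and
`xᵉ z = Q(x, y) - s`. -/
noncomputable def doubleDanielewskiModel {n e d m : ℕ} (hd : 2 ≤ d) (hm : 2 ≤ m) {f g : ℕ → k[X]}
    (hx : ι x = Polynomial.C (tpow k 1)) (hs : ι s = Polynomial.X)
    (hxy : x ^ n * y = monicEval d f x s) (hyz : x ^ e * z = monicEval m g x y - s)
    (hgen : Algebra.adjoin k {x, s, y, z} = ⊤) :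
    DegreeModel k A where
  ι := ι
  x := x
  b J := s ^ (J % d) * y ^ (J / d % m) * z ^ (J / (d * m))
  w J := n * (J / d % m) + (n * m + e) * (J / (d * m))
  ι_x := hx
  b_zero := by simp
  ι_b_one := by
    rw [Nat.mod_eq_of_lt (by omega), ← Nat.div_div_eq_div_mul, Nat.div_eq_of_lt (by omega : 1 < d),
      Nat.zero_mod, Nat.zero_div, pow_one, pow_zero, mul_one, pow_zero, mul_one, hs]
  natDegree_b J := by
    obtain ⟨h1, -⟩ := natDegree_ι_y ι hx hs hxy
    obtain ⟨h3, -⟩ := natDegree_ι_z ι hd hm hx hs hxy hyz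
    have hy : ι y ≠ 0 := fun h0 => by
      rw [h0, natDegree_zero] at h1
      omega
    have hz : ι z ≠ 0 := fun h0 => by
      rw [h0, natDegree_zero] at h3
      exact (Nat.mul_pos (by omega : 0 < d) (by omega : 0 < m)).ne h3
    rw [map_mul, map_mul, map_pow, map_pow, map_pow, hs,
      natDegree_mul (mul_ne_zero (pow_ne_zero _ Polynomial.X_ne_zero) (pow_ne_zero _ hy))
      (pow_ne_zero _ hz), natDegree_mul (pow_ne_zero _ Polynomial.X_ne_zero)
      (pow_ne_zero _ hy), natDegree_X_pow, natDegree_pow, natDegree_pow, h1, h3]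
    have h4 := Nat.mod_add_div J d
    have h5 := Nat.mod_add_div (J / d) m
    rw [Nat.div_div_eq_div_mul] at h5
    calc _ = J % d + d * (J / d % m + m * (J / (d * m))) := by ring
      _ = J := by rw [h5, h4]
  leadingCoeff_b J := by
    obtain ⟨-, h2⟩ := natDegree_ι_y ι hx hs hxy
    obtain ⟨-, h3⟩ := natDegree_ι_z ι hd hm hx hs hxy hyz
    rw [map_mul, map_mul, map_pow, map_pow, map_pow, hs, leadingCoeff_mul, leadingCoeff_mul,
      leadingCoeff_X_pow, one_mul, leadingCoeff_pow, leadingCoeff_pow, h2, h3, tpow_pow, tpow_pow,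
      HahnSeries.single_mul_single, mul_one]
    refine congrArg (tpow k) ?_
    push_cast
    ring
  span := by
    refine mem_span_range_of_mul_mem hgen (by simp) fun c hc J => ?_
    set W := Submodule.span (Algebra.adjoin k {x})
      (Set.range fun J => s ^ (J % d) * y ^ (J / d % m) * z ^ (J / (d * m))) with hW
    have hmon : ∀ j p q, s ^ j * y ^ p * z ^ q ∈ W := by
      refine monomial_mem_of_reduced_mem₃ hd hm hxy hyz W fun j p q hj hp => ?_
      refine Submodule.subset_span ⟨j + d * (p + m * q), ?_⟩
      simp only
      rw [Nat.add_mul_mod_self_left, Nat.mod_eq_of_lt hj, ← Nat.div_div_eq_div_mul,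
        Nat.add_mul_div_left _ _ (by omega), Nat.div_eq_of_lt hj, zero_add,
        Nat.add_mul_mod_self_left, Nat.mod_eq_of_lt hp, Nat.add_mul_div_left _ _ (by omega),
        Nat.div_eq_of_lt hp, zero_add]
    rcases hc with rfl | rfl | rfl | rfl
    · exact W.smul_mem ⟨_, Algebra.self_mem_adjoin_singleton k c⟩ (hmon _ _ _)
    · rw [← mul_assoc, ← mul_assoc, ← pow_succ']
      exact hmon _ _ _
    · rw [← mul_assoc, mul_left_comm, ← pow_succ']
      exact hmon _ _ _
    · rw [mul_left_comm, ← pow_succ']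
      exact hmon _ _ _
  clear_denominators a := by
    rw [Nat.mod_eq_of_lt (by omega), ← Nat.div_div_eq_div_mul, Nat.div_eq_of_lt (by omega : 1 < d),
      Nat.zero_mod, Nat.zero_div, pow_one, pow_zero, mul_one, pow_zero, mul_one]
    have hx' : x ∈ Algebra.adjoin k {x, s} := Algebra.subset_adjoin (by simp)
    have hs' : s ∈ Algebra.adjoin k {x, s} := Algebra.subset_adjoin (by simp)
    have hy' : y ∈ clearedSubalgebra _ hx' := by
      refine mem_clearedSubalgebra_of_pow_mul_mem hx' (N := n) ?_
      rw [hxy]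
      exact le_clearedSubalgebra hx' (monicEval_mem _ d f hx' hs')
    have hle : Algebra.adjoin k {x, s, y, z} ≤ clearedSubalgebra _ hx' := by
      refine Algebra.adjoin_le ?_
      rintro c (rfl | rfl | rfl | rfl)
      · exact le_clearedSubalgebra hx' hx'
      · exact le_clearedSubalgebra hx' hs'
      · exact hy'
      · refine mem_clearedSubalgebra_of_pow_mul_mem hx' (N := e) ?_
        rw [hyz]
        exact sub_mem (monicEval_mem _ m g (le_clearedSubalgebra hx' hx') hy')
          (le_clearedSubalgebra hx' hs')
    exact hle (hgen ▸ Algebra.mem_top)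

end Models

namespace DegreeModel

open Polynomial

variable {k A : Type*} [Field k] [CommRing A] [Algebra k A] (M : DegreeModel k A)

theorem exists_ι_eq_derivative {a : A} (ha : a ∈ Algebra.adjoin k {M.x, M.b 1}) :
    ∃ a', M.ι a' = derivative (M.ι a) := by
  induction ha using Algebra.adjoin_induction with
  | mem a ha =>
    rcases ha with rfl | rfl
    · exact ⟨0, by rw [M.ι_x, map_zero, derivative_C]⟩
    · exact ⟨1, by rw [M.ι_b_one, derivative_X, map_one]⟩
  | algebraMap r =>
    exact ⟨0, by rw [AlgHom.commutes, map_zero, Polynomial.algebraMap_apply, derivative_C]⟩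
  | add a b _ _ ha hb =>
    obtain ⟨a', ha⟩ := ha
    obtain ⟨b', hb⟩ := hb
    exact ⟨a' + b', by rw [ι_add, ι_add, ha, hb, derivative_add]⟩
  | mul a b _ _ ha hb =>
    obtain ⟨a', ha⟩ := ha
    obtain ⟨b', hb⟩ := hb
    exact ⟨a' * b + a * b', by rw [ι_add, ι_mul, ι_mul, ι_mul, ha, hb, derivative_mul]⟩

/-- If `xⁿ ∂/∂s` maps generators into `A`, it is a nonzero locally nilpotent derivation of `A`
killing `x`. -/
theorem exists_isLND {G : Set A} (hG : Algebra.adjoin k G = ⊤) (n : ℕ)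
    (h : ∀ g ∈ G, ∃ a', M.ι a' = M.ι (M.x ^ n) * derivative (M.ι g)) :
    ∃ D : Derivation k A A, IsLND D ∧ D ≠ 0 ∧ D M.x = 0 := by
  have hall : ∀ a, ∃ a', M.ι a' = M.ι (M.x ^ n) * derivative (M.ι a) := by
    intro a
    have ha : a ∈ Algebra.adjoin k G := hG ▸ Algebra.mem_top
    induction ha using Algebra.adjoin_induction with
    | mem a ha => exact h a ha
    | algebraMap r =>
      exact ⟨0, by rw [AlgHom.commutes, map_zero, Polynomial.algebraMap_apply, derivative_C,
        mul_zero]⟩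
    | add a b _ _ ha hb =>
      obtain ⟨a', ha⟩ := ha
      obtain ⟨b', hb⟩ := hb
      exact ⟨a' + b', by rw [ι_add, ι_add, ha, hb, derivative_add, mul_add]⟩
    | mul a b _ _ ha hb =>
      obtain ⟨a', ha⟩ := ha
      obtain ⟨b', hb⟩ := hb
      refine ⟨a' * b + a * b', ?_⟩
      rw [ι_add, ι_mul, ι_mul, ι_mul, ha, hb, derivative_mul]
      ring
  choose δ hδ using hall
  let D : Derivation k A A := Derivation.mk'
    { toFun := δ
      map_add' := fun a b => M.ι_injective (by
        rw [hδ, ι_add, ι_add, hδ, hδ, derivative_add, mul_add])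
      map_smul' := fun c a => M.ι_injective (by
        rw [hδ, RingHom.id_apply, Algebra.smul_def, Algebra.smul_def, ι_mul, ι_mul, hδ,
          AlgHom.commutes, Polynomial.algebraMap_apply, derivative_C_mul, mul_left_comm]) }
    fun a b => M.ι_injective (by
      simp only [LinearMap.coe_mk, AddHom.coe_mk, smul_eq_mul]
      rw [hδ, ι_add, ι_mul, ι_mul, ι_mul, hδ, hδ, derivative_mul]
      ring)
  have hD : ∀ a, M.ι (D a) = M.ι (M.x ^ n) * derivative (M.ι a) := hδ
  refine ⟨D, fun a => ⟨(M.ι a).natDegree + 1, ?_⟩, ?_, M.ι_injective ?_⟩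
  · have hiter : ∀ t : ℕ, M.ι ((⇑D)^[t] a) =
        M.ι (M.x ^ n) ^ t * derivative^[t] (M.ι a) := by
      intro t
      induction t with
      | zero => simp
      | succ t ih =>
        rw [Function.iterate_succ_apply', hD, ih, ι_x_pow, ← Polynomial.C_pow,
          derivative_C_mul, Function.iterate_succ_apply', ← mul_assoc, ← Polynomial.C_mul,
          ← pow_succ', Polynomial.C_pow]
    refine (Module.End.pow_apply _ _ _).trans (M.ι_injective ?_)
    change M.ι ((⇑D)^[_] a) = _
    rw [hiter, iterate_derivative_eq_zero (Nat.lt_succ_self _), mul_zero, map_zero]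
  · intro h0
    have h1 := hD (M.b 1)
    rw [h0, M.ι_b_one, derivative_X, mul_one, Derivation.zero_apply, map_zero, ι_x_pow, eq_comm,
      Polynomial.C_eq_zero] at h1
    exact pow_ne_zero n (HahnSeries.single_ne_zero one_ne_zero) h1
  · rw [hD, M.ι_x, derivative_C, mul_zero, map_zero]

theorem x_ne_algebraMap (M : DegreeModel k A) (c : k) : M.x ≠ algebraMap k A c := by
  intro h
  have h1 : Polynomial.aeval M.x (Polynomial.X : k[X]) = Polynomial.aeval M.x (Polynomial.C c) := by
    rw [Polynomial.aeval_X, Polynomial.aeval_C, h]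
  exact Polynomial.X_ne_C c (M.aeval_injective h1)

end DegreeModel

section Rings

open Polynomial

variable (k : Type*) [Field k]

theorem C_tpow_pow_mul (n : ℕ) (p : (LaurentSeries k)[X]) :
    Polynomial.C (tpow k 1) ^ n * (Polynomial.C (tpow k (-(n : ℤ))) * p) = p := by
  rw [← Polynomial.C_pow, ← mul_assoc, ← Polynomial.C_mul, tpow_pow, HahnSeries.single_mul_single]
  simp

theorem adjoin_mk_X (I : Ideal (MvPolynomial (Fin 3) k)) :
    Algebra.adjoin k {Ideal.Quotient.mkₐ k I (MvPolynomial.X 0),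
      Ideal.Quotient.mkₐ k I (MvPolynomial.X 1),
      Ideal.Quotient.mkₐ k I (MvPolynomial.X 2)} = ⊤ := by
  have h := congrArg (Subalgebra.map (Ideal.Quotient.mkₐ k I))
    (MvPolynomial.adjoin_range_X (R := k) (σ := Fin 3))
  rw [AlgHom.map_adjoin, Algebra.map_top, (AlgHom.range_eq_top _).2
    (Ideal.Quotient.mkₐ_surjective k I)] at h
  rw [← h]
  congr 1
  ext a
  simp [Fin.exists_fin_succ, eq_comm]

variable [CharZero k]

theorem exists_danRing_model (n l : ℕ) (hl : 2 ≤ l) (h : ℕ → k[X]) :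
    ∃ M : DegreeModel k (DanRing k n l h), (∀ J, M.w J = n * (J / l)) ∧
      ∃ D : Derivation k (DanRing k n l h) (DanRing k n l h),
        IsLND D ∧ D ≠ 0 ∧ D M.x = 0 := by
  set Φ : MvPolynomial (Fin 3) k →ₐ[k] (LaurentSeries k)[X] := MvPolynomial.aeval
    ![Polynomial.C (tpow k 1), Polynomial.X,
      Polynomial.C (tpow k (-(n : ℤ))) *
        monicEval l h (Polynomial.C (tpow k 1)) Polynomial.X] with hΦ
  have hΦ0 : ∀ a ∈ DanIdeal k n l h, Φ a = 0 := by
    intro a ha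
    refine (Ideal.span_le.2 ?_ : DanIdeal k n l h ≤ RingHom.ker Φ) ha
    rintro _ rfl
    rw [SetLike.mem_coe, RingHom.mem_ker, map_sub, Pat_eq_monicEval, map_monicEval, map_mul,
      map_pow]
    simp [hΦ, C_tpow_pow_mul]
  let ι : DanRing k n l h →ₐ[k] (LaurentSeries k)[X] :=
    Ideal.Quotient.liftₐ (DanIdeal k n l h) Φ hΦ0
  let π : MvPolynomial (Fin 3) k →ₐ[k] DanRing k n l h := Ideal.Quotient.mkₐ k (DanIdeal k n l h)
  have hι : ∀ a, ι (π a) = Φ a := fun a => rfl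
  have hgen : Algebra.adjoin k {π (MvPolynomial.X 0), π (MvPolynomial.X 1),
      π (MvPolynomial.X 2)} = ⊤ := adjoin_mk_X k _
  have hxy : π (MvPolynomial.X 0) ^ n * π (MvPolynomial.X 2) =
      monicEval l h (π (MvPolynomial.X 0)) (π (MvPolynomial.X 1)) := by
    rw [← map_pow, ← map_mul, ← map_monicEval]
    exact Ideal.Quotient.eq.2 (Ideal.subset_span rfl)
  have hx : ι (π (MvPolynomial.X 0)) = Polynomial.C (tpow k 1) := by simp [hι, hΦ]
  have hs : ι (π (MvPolynomial.X 1)) = Polynomial.X := by simp [hι, hΦ]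
  let M := danielewskiModel ι hl hx hs hxy hgen
  refine ⟨M, fun J => rfl, M.exists_isLND hgen n ?_⟩
  have hs1 : M.b 1 = π (MvPolynomial.X 1) := M.ι_injective (M.ι_b_one.trans hs.symm)
  have hxmem : π (MvPolynomial.X 0) ∈ Algebra.adjoin k {M.x, M.b 1} :=
    Algebra.subset_adjoin (Or.inl rfl)
  have hsmem : π (MvPolynomial.X 1) ∈ Algebra.adjoin k {M.x, M.b 1} :=
    Algebra.subset_adjoin (Or.inr hs1.symm)
  have hmul : ∀ a ∈ Algebra.adjoin k {M.x, M.b 1},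
      ∃ a', M.ι a' = M.ι (M.x ^ n) * derivative (M.ι a) := fun a ha => by
    obtain ⟨a', ha'⟩ := M.exists_ι_eq_derivative ha
    exact ⟨M.x ^ n * a', by rw [M.ι_mul, ha']⟩
  rintro a (rfl | rfl | rfl)
  · exact hmul _ hxmem
  · exact hmul _ hsmem
  · obtain ⟨a', ha'⟩ := M.exists_ι_eq_derivative (monicEval_mem _ l h hxmem hsmem)
    refine ⟨a', ?_⟩
    rw [ha', ← hxy, M.ι_mul]
    exact (congrArg derivative (congrArg (· * _) (M.ι_x_pow n))).trans
      ((derivative_C_mul _ _).trans (congrArg (· * _) (M.ι_x_pow n).symm))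

theorem exists_rRing_model (n e d m : ℕ) (hd : 2 ≤ d) (hm : 2 ≤ m) (f g : ℕ → k[X]) :
    ∃ M : DegreeModel k (RRing k n e d m f g),
      (∀ J, M.b J = M.b 1 ^ (J % d) * M.b d ^ (J / d % m) * M.b (d * m) ^ (J / (d * m))) ∧
      ∀ J, M.w J = n * (J / d % m) + (n * m + e) * (J / (d * m)) := by
  set Y : (LaurentSeries k)[X] := Polynomial.C (tpow k (-(n : ℤ))) *
    monicEval d f (Polynomial.C (tpow k 1)) Polynomial.X with hY
  set Φ : MvPolynomial (Fin 3) k →ₐ[k] (LaurentSeries k)[X] := MvPolynomial.aeval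
    ![Polynomial.C (tpow k 1), Y, Polynomial.C (tpow k (-(e : ℤ))) *
        (monicEval m g (Polynomial.C (tpow k 1)) Y - Polynomial.X)] with hΦ
  have hΦs : Φ (Qpoly k m g - MvPolynomial.X 0 ^ e * MvPolynomial.X 2) = Polynomial.X := by
    rw [map_sub, Qpoly_eq_monicEval, map_monicEval, map_mul, map_pow]
    simp [hΦ, C_tpow_pow_mul]
  have hΦ0 : ∀ a ∈ RIdeal k n e d m f g, Φ a = 0 := by
    intro a ha
    refine (Ideal.span_le.2 ?_ : RIdeal k n e d m f g ≤ RingHom.ker Φ) ha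
    rintro _ rfl
    rw [SetLike.mem_coe, RingHom.mem_ker, map_sub, Pat_eq_monicEval, map_monicEval, hΦs, map_mul,
      map_pow]
    simp [hΦ, hY, C_tpow_pow_mul]
  let ι : RRing k n e d m f g →ₐ[k] (LaurentSeries k)[X] :=
    Ideal.Quotient.liftₐ (RIdeal k n e d m f g) Φ hΦ0
  let π : MvPolynomial (Fin 3) k →ₐ[k] RRing k n e d m f g :=
    Ideal.Quotient.mkₐ k (RIdeal k n e d m f g)
  have hι : ∀ a, ι (π a) = Φ a := fun a => rfl
  set s := π (Qpoly k m g - MvPolynomial.X 0 ^ e * MvPolynomial.X 2) with hs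
  have hgen : Algebra.adjoin k {π (MvPolynomial.X 0), s, π (MvPolynomial.X 1),
      π (MvPolynomial.X 2)} = ⊤ := by
    refine top_le_iff.1 ((adjoin_mk_X k (RIdeal k n e d m f g)).ge.trans
      (Algebra.adjoin_mono ?_))
    rintro a (rfl | rfl | rfl)
    exacts [Or.inl rfl, Or.inr (Or.inr (Or.inl rfl)), Or.inr (Or.inr (Or.inr rfl))]
  have hxy : π (MvPolynomial.X 0) ^ n * π (MvPolynomial.X 1) =
      monicEval d f (π (MvPolynomial.X 0)) s := by
    rw [← map_pow, ← map_mul, hs, ← map_monicEval]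
    exact Ideal.Quotient.eq.2 (Ideal.subset_span rfl)
  have hyz : π (MvPolynomial.X 0) ^ e * π (MvPolynomial.X 2) =
      monicEval m g (π (MvPolynomial.X 0)) (π (MvPolynomial.X 1)) - s := by
    rw [hs, map_sub, Qpoly_eq_monicEval, map_monicEval, map_mul, map_pow, sub_sub_cancel]
  let M := doubleDanielewskiModel ι hd hm (by simp [hι, hΦ]) (hΦs : ι s = _) hxy hyz hgen
  have hb : ∀ J, M.b J = s ^ (J % d) * π (MvPolynomial.X 1) ^ (J / d % m) *
      π (MvPolynomial.X 2) ^ (J / (d * m)) := fun J => rfl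
  refine ⟨M, fun J => ?_, fun J => rfl⟩
  have hdm : d < d * m := by nlinarith
  have h1 : M.b 1 = s := M.ι_injective (M.ι_b_one.trans hΦs.symm)
  have h2 : M.b d = π (MvPolynomial.X 1) := by
    rw [hb, Nat.mod_self, Nat.div_self (by omega), Nat.mod_eq_of_lt (by omega),
      Nat.div_eq_of_lt hdm]
    simp
  have h3 : M.b (d * m) = π (MvPolynomial.X 2) := by
    rw [hb, Nat.mul_mod_right, Nat.mul_div_cancel_left _ (by omega), Nat.mod_self,
      Nat.div_self (by omega)]
    simp
  rw [h1, h2, h3, hb]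

end Rings

theorem stmt17 {k : Type*} [Field k] [CharZero k]
    (n₁ n₂ e d m l : ℕ)
    (hn₁ : 1 ≤ n₁) (hn₂ : 1 ≤ n₂) (he : 1 ≤ e)
    (hd : 2 ≤ d) (hm : 2 ≤ m) (hl : 2 ≤ l)
    (f g h : ℕ → Polynomial k) :
    ¬ Nonempty (RRing k n₁ e d m f g ≃ₐ[k] DanRing k n₂ l h) := by
  rintro ⟨φ⟩
  obtain ⟨M', hw', D, hD, hD0, hDx'⟩ := exists_danRing_model k n₂ l hl h
  obtain ⟨M₀, hb, hw⟩ := exists_rRing_model k n₁ e d m hd hm f g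
  let M := M₀.transport φ
  have hbM : ∀ J, M.b J = M.b 1 ^ (J % d) * M.b d ^ (J / d % m) * M.b (d * m) ^ (J / (d * m)) :=
    fun J => (congrArg φ (hb J)).trans (by simp only [map_mul, map_pow]; rfl)
  have hDx := M.apply_x_eq_zero hn₁ he hd hm hbM hw hD hDx' M'.x_ne_algebraMap
  obtain ⟨N, hN⟩ := M.exists_w_eq_mul M' hD hD0 hDx hDx'
  have hcomp : ∀ J, n₁ * (J / d % m) + (n₁ * m + e) * (J / (d * m)) = N * (n₂ * (J / l)) :=
    fun J => by rw [← hw, ← hw']; exact hN J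
  have hdm : d < d * m := by nlinarith
  have h₁ : n₁ = N * (n₂ * (d / l)) := by
    have := hcomp d
    rwa [Nat.div_self (by omega), Nat.mod_eq_of_lt (by omega), Nat.div_eq_of_lt hdm, mul_one,
      mul_zero, add_zero] at this
  have hle : l ≤ d := by
    by_contra hlt
    rw [Nat.div_eq_of_lt (not_le.1 hlt), mul_zero, mul_zero] at h₁
    omega
  have hge : d ≤ l := by
    by_contra hlt
    have h₂ := hcomp l
    rw [Nat.div_eq_of_lt (not_le.1 hlt), Nat.div_eq_of_lt (by omega), Nat.zero_mod,
      Nat.div_self (by omega), mul_zero, mul_zero, mul_one, add_zero] at h₂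
    rw [← mul_assoc, ← h₂, zero_mul] at h₁
    omega
  obtain rfl := le_antisymm hle hge
  rw [Nat.div_self (by omega), mul_one] at h₁
  have h₃ := hcomp (l * m)
  rw [Nat.mul_div_cancel_left _ (by omega), Nat.mod_self, Nat.div_self (by nlinarith),
    ← mul_assoc, ← h₁] at h₃
  omega
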